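/- arXiv:1401.1335 — 3 statements merged into one kernel-verified Lean document; each statement's English description precedes it below -/
import Mathlib

section
/- Let G be a finite group, let p be the smallest prime dividing |G|, and let P be a Sylow p-subgroup of G. If every maximal subgroup of P is c-normal in G, then G is p-nilpotent. -/
open scoped Pointwise

/-- A group `G` is `p`-nilpotent if it has a normal `p`-complement, i.e. a normal
subgroup `N` whose order is not divisible by `p` and whose index is a power of `p`. -/
def IsPNilpotent (p : ℕ) (G : Type*) [Group G] : Prop :=
  ∃ N : Subgroup G, N.Normal ∧ ¬ p ∣ Nat.card N ∧ ∃ k : ℕ, N.index = p ^ k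

/-- A subgroup `H` of `G` is c-normal in `G` if there is a normal subgroup `T`
with `G = HT` and `H ⊓ T` contained in the normal core of `H`. -/
def Subgroup.IsCNormal {G : Type*} [Group G] (H : Subgroup G) : Prop :=
  ∃ T : Subgroup G, T.Normal ∧ (H : Set G) * (T : Set G) = Set.univ ∧ H ⊓ T ≤ H.normalCore

/-- A subgroup `H` of `G` is S-quasinormal in `G` if it permutes with every Sylow
subgroup of `G`. -/
def Subgroup.IsSQuasinormal {G : Type*} [Group G] (H : Subgroup G) : Prop :=
  ∀ q : ℕ, q.Prime → ∀ Q : Sylow q G,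
    (H : Set G) * ((Q : Subgroup G) : Set G) = ((Q : Subgroup G) : Set G) * (H : Set G)

/-- A subgroup `H` of `G` has a `p`-nilpotent supplement in `G` if there is a
subgroup `K` with `G = HK` and `K` `p`-nilpotent. -/
def HasPNilpotentSupplement (p : ℕ) {G : Type*} [Group G] (H : Subgroup G) : Prop :=
  ∃ K : Subgroup G, (H : Set G) * (K : Set G) = Set.univ ∧ IsPNilpotent p K

/-- `M` is a maximal (proper) subgroup of `P`. -/
def IsMaximalSubgroupOf {G : Type*} [Group G] (M P : Subgroup G) : Prop :=
  M < P ∧ ∀ K : Subgroup G, M < K → K ≤ P → K = P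

/-- `P` is a Sylow `p`-subgroup of the subgroup `E`: a maximal `p`-subgroup of `E`. -/
def IsSylowSubgroupOf (p : ℕ) {G : Type*} [Group G] (P E : Subgroup G) : Prop :=
  P ≤ E ∧ IsPGroup p P ∧ ∀ Q : Subgroup G, Q ≤ E → IsPGroup p Q → P ≤ Q → Q = P

/-- A group is supersolvable if it has a chain of subgroups from `⊥` to `⊤`,
each normal in `G`, in which each successive quotient is cyclic (i.e. each step
is generated by the previous one together with a single element). -/
def IsSupersolvable (G : Type*) [Group G] : Prop :=
  ∃ (n : ℕ) (c : ℕ → Subgroup G), c 0 = ⊥ ∧ c n = ⊤ ∧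
    (∀ i, c i ≤ c (i + 1)) ∧ (∀ i, (c i).Normal) ∧
    ∀ i, ∃ x ∈ c (i + 1), c i ⊔ Subgroup.zpowers x = c (i + 1)

theorem aux_pnil_of_burnside {C : Type*} [Group C] [Finite C] {p : ℕ} [Fact p.Prime]
    (S : Sylow p C) (hS : Subgroup.normalizer (S : Set C) ≤ Subgroup.centralizer (S : Set C)) :
    IsPNilpotent p C := by
  refine ⟨(MonoidHom.transferSylow S hS).ker, inferInstance,
    MonoidHom.not_dvd_card_ker_transferSylow S hS, ?_⟩
  rw [Subgroup.index_ker]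
  obtain ⟨k, hk⟩ := S.2.exists_card_eq
  have : Nat.card (MonoidHom.transferSylow S hS).range ∣ p ^ k := by
    rw [← hk]; exact Subgroup.card_subgroup_dvd_card _
  obtain ⟨j, _, hj⟩ := (Nat.dvd_prime_pow Fact.out).1 this
  exact ⟨j, hj⟩

/-- Lemma 1: p-nilpotency lifts from a normal subgroup of p-power index. -/
theorem aux_lift {G : Type*} [Group G] [Finite G] {p : ℕ} [hp : Fact p.Prime]
    (C : Subgroup G) [C.Normal] (hC : ∃ k, C.index = p ^ k) (h : IsPNilpotent p C) :
    IsPNilpotent p G := by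
  obtain ⟨N, hN, hcard, k, hk⟩ := h
  obtain ⟨l, hl⟩ := hC
  refine ⟨N.map C.subtype, ⟨?_⟩, ?_, k + l, ?_⟩
  · rintro _ ⟨x, hx, rfl⟩ g
    have hmem : g * (x : G) * g⁻¹ ∈ C := ‹C.Normal›.conj_mem _ x.2 g
    refine ⟨⟨_, hmem⟩, ?_, rfl⟩
    set y : C := ⟨_, hmem⟩ with hy
    have ho : orderOf y = orderOf x := by
      rw [← Subgroup.orderOf_coe, ← Subgroup.orderOf_coe x, hy]
      exact orderOf_injective (MulAut.conj g).toMonoidHom (MulAut.conj g).injective (x : G)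
    have hox : orderOf x ∣ Nat.card N := by
      have := orderOf_dvd_natCard (⟨x, hx⟩ : N)
      rwa [← Subgroup.orderOf_coe] at this
    have hcop : (Nat.card N).Coprime (p ^ k) :=
      (((Nat.Prime.coprime_iff_not_dvd hp.out).2 hcard).symm).pow_right k
    have h1 : orderOf (QuotientGroup.mk' N y) ∣ Nat.card N :=
      (orderOf_map_dvd _ y).trans (ho ▸ hox)
    have h2 : orderOf (QuotientGroup.mk' N y) ∣ p ^ k := by
      rw [← hk, Subgroup.index_eq_card]; exact orderOf_dvd_natCard _
    have h3 := Nat.eq_one_of_dvd_coprimes hcop h1 h2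
    rw [orderOf_eq_one_iff] at h3
    exact (QuotientGroup.eq_one_iff y).1 h3
  · rwa [Subgroup.card_map_of_injective C.subtype_injective]
  · rw [Subgroup.index_map_subtype, hk, hl, pow_add]

/-- A maximal subgroup of a Sylow subgroup has index p. -/
theorem aux_max_card {G : Type*} [Group G] [Finite G] {p : ℕ} [hp : Fact p.Prime]
    (P M : Subgroup G) (hP : IsPGroup p P) (hM : IsMaximalSubgroupOf M P) :
    Nat.card M * p = Nat.card P := by
  obtain ⟨hlt, hmax⟩ := hM
  obtain ⟨n, hn⟩ := hP.exists_card_eq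
  obtain ⟨m, hm⟩ := (hP.to_le hlt.le).exists_card_eq
  have hmn : m < n := by
    by_contra hle
    apply hlt.ne
    apply Subgroup.eq_of_le_of_card_ge hlt.le
    rw [hn, hm]
    exact Nat.pow_le_pow_right hp.out.pos (not_lt.1 hle)
  have hc : Nat.card (M.subgroupOf P) = p ^ m := by
    rw [← hm]; exact Nat.card_congr (Subgroup.subgroupOfEquivOfLe hlt.le).toEquiv
  obtain ⟨K, hK, hMK⟩ := Sylow.exists_subgroup_card_pow_succ (G := P)
    (hn ▸ pow_dvd_pow p hmn : p ^ (m + 1) ∣ Nat.card P) hc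
  have hKc : Nat.card (K.map P.subtype) = p ^ (m + 1) := by
    rw [Subgroup.card_map_of_injective P.subtype_injective, hK]
  have hle : M ≤ K.map P.subtype := by
    rw [← Subgroup.map_subgroupOf_eq_of_le hlt.le]
    exact Subgroup.map_mono hMK
  have hlt' : M < K.map P.subtype := by
    refine lt_of_le_of_ne hle fun he => ?_
    rw [← he, hm] at hKc
    have := Nat.pow_right_injective hp.out.two_le hKc
    omega
  have := hmax _ hlt' (Subgroup.map_subtype_le K)
  rw [← this, hKc, hm, pow_succ]

theorem aux_key {G : Type*} [Group G] [Finite G] {p : ℕ} [hp : Fact p.Prime]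
    (hmin : ∀ q : ℕ, q.Prime → q ∣ Nat.card G → p ≤ q)
    (P : Sylow p G) (M : Subgroup G) (hM : IsMaximalSubgroupOf M (P : Subgroup G))
    (hc : M.IsCNormal) :
    ∃ K : Subgroup G, K.Normal ∧ (∃ k, K.index = p ^ k) ∧
      ((P : Subgroup G) ⊓ K).Normal ∧ (P : Subgroup G) ⊓ K ≤ M := by
  have hcardM := aux_max_card (P : Subgroup G) M P.2 hM
  obtain ⟨T, hT, hMT, hle⟩ := hc
  have hD : M ⊓ T = M.normalCore ⊓ T :=
    le_antisymm (le_inf hle inf_le_right) (inf_le_inf_right _ (Subgroup.normalCore_le M))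
  have hDn : (M ⊓ T).Normal := by
    rw [hD]; infer_instance
  set D := M ⊓ T with hDdef
  have hsup : M ⊔ T = ⊤ := by
    rw [SetLike.ext'_iff, Subgroup.mul_normal, hMT]; rfl
  have hidx : T.index = T.relIndex M := by
    rw [← Subgroup.relIndex_top_right, ← hsup, Subgroup.relIndex_sup_right]
  have hMD : Nat.card D * T.relIndex M = Nat.card M := by
    rw [← Subgroup.inf_relIndex_left, ← Subgroup.relIndex_bot_left, ← Subgroup.relIndex_bot_left,
      Subgroup.relIndex_mul_relIndex _ _ _ bot_le inf_le_left]
  obtain ⟨m, hm⟩ := (P.2.to_le hM.1.le).exists_card_eq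
  have hTidx : ∃ k, T.index = p ^ k := by
    obtain ⟨k, _, hk⟩ := (Nat.dvd_prime_pow hp.out).1 (hm ▸ Dvd.intro_left _ hMD)
    exact ⟨k, hidx.trans hk⟩
  let f := QuotientGroup.mk' D
  have hfs : Function.Surjective f := QuotientGroup.mk'_surjective D
  have hker : f.ker = D := QuotientGroup.ker_mk' D
  let B := T.map f
  have hBn : B.Normal := hT.map f hfs
  have hBidx : B.index = T.index := Subgroup.index_map_eq T hfs (by rw [hker]; exact inf_le_right)
  have hBcard : Nat.card B = p * (P : Subgroup G).index := by
    have h1 := B.card_mul_index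
    have h2 := D.card_mul_index
    have h3 := (P : Subgroup G).card_mul_index
    rw [Subgroup.index_eq_card] at h2
    have hpos : 0 < Nat.card M := Nat.card_pos
    apply Nat.eq_of_mul_eq_mul_right hpos
    rw [← hMD]
    rw [hBidx, hidx] at h1
    calc _ = Nat.card D * (Nat.card B * T.relIndex M) := by ring
      _ = Nat.card G := by rw [h1, h2]
      _ = Nat.card M * p * (P : Subgroup G).index := by rw [hcardM, h3]
      _ = _ := by rw [← hMD]; ring
  have hBdvd : Nat.card B ∣ Nat.card G :=
    (Subgroup.card_map_dvd T f).trans (Subgroup.card_subgroup_dvd_card T)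
  have hpB : p ∣ Nat.card B := hBcard ▸ Dvd.intro _ rfl
  have hBmin : (Nat.card B).minFac = p := by
    apply le_antisymm (Nat.minFac_le_of_dvd hp.out.two_le hpB)
    have : Nat.card B ≠ 1 := fun h => hp.out.one_lt.ne' (Nat.dvd_one.1 (h ▸ hpB))
    exact hmin _ (Nat.minFac_prime this) ((Nat.minFac_dvd _).trans hBdvd)
  have hBnil : IsPNilpotent p B := by
    obtain ⟨S⟩ : Nonempty (Sylow p B) := inferInstance
    have hSc : Nat.card S = p := by
      obtain ⟨k, hk⟩ := S.2.exists_card_eq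
      have h1 : p ∣ Nat.card S := S.dvd_card_of_dvd_card hpB
      have h2 : Nat.card S ∣ p * (P : Subgroup G).index :=
        hBcard ▸ Subgroup.card_subgroup_dvd_card _
      have h0 : k ≠ 0 := by
        rintro rfl
        rw [pow_zero] at hk
        exact hp.out.one_lt.ne' (Nat.dvd_one.1 (hk ▸ h1))
      have h3 : k < 2 := by
        by_contra h
        have : p ^ 2 ∣ p * (P : Subgroup G).index :=
          (pow_dvd_pow p (not_lt.1 h)).trans (hk ▸ h2)
        rw [pow_two] at this
        exact P.not_dvd_index (Nat.dvd_of_mul_dvd_mul_left hp.out.pos this)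
      have : k = 1 := by omega
      rw [this, pow_one] at hk
      exact hk
    have hcyc : IsCyclic S := isCyclic_of_prime_card hSc
    exact aux_pnil_of_burnside S (hcyc.normalizer_le_centralizer hBmin)
  have hQ : IsPNilpotent p (G ⧸ D) := by
    apply aux_lift B _ hBnil
    rw [hBidx]; exact hTidx
  obtain ⟨L, hL, hLc, hLi⟩ := hQ
  have hPK : (P : Subgroup G) ⊓ L.comap f = D := by
    apply le_antisymm
    · have h1 : IsPGroup p (((P : Subgroup G) ⊓ L.comap f).map f) :=
        (P.2.to_le inf_le_left).map f
      have h2 : ((P : Subgroup G) ⊓ L.comap f).map f ≤ L :=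
        (Subgroup.map_mono inf_le_right).trans (Subgroup.map_comap_le _ _)
      have h3 : ((P : Subgroup G) ⊓ L.comap f).map f = ⊥ := by
        rcases h1.card_eq_or_dvd with h | h
        · exact Subgroup.card_eq_one.1 h
        · exact absurd (h.trans (Subgroup.card_dvd_of_le h2)) hLc
      rwa [Subgroup.map_eq_bot_iff, hker] at h3
    · refine le_inf (inf_le_left.trans hM.1.le) ?_
      exact hker.symm.le.trans (Subgroup.ker_le_comap f L)
  refine ⟨L.comap f, inferInstance, ?_, ?_, ?_⟩
  · rw [Subgroup.index_comap_of_surjective _ hfs]; exact hLi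
  · rw [hPK]; exact hDn
  · rw [hPK]; exact inf_le_left

theorem aux_exists_max {G : Type*} [Group G] [Finite G] (R P : Subgroup G) (h : R < P) :
    ∃ M, R ≤ M ∧ IsMaximalSubgroupOf M P := by
  obtain ⟨M, ⟨hRM, hMP⟩, hmax⟩ := Set.Finite.exists_maximal (Set.toFinite {M : Subgroup G | R ≤ M ∧ M < P})
    ⟨R, le_rfl, h⟩
  refine ⟨M, hRM, hMP, fun K hMK hKP => ?_⟩
  by_contra hne
  exact hMK.not_ge (hmax ⟨hRM.trans hMK.le, lt_of_le_of_ne hKP hne⟩ hMK.le)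

theorem aux_final {G : Type*} [Group G] [Finite G] {p : ℕ} [hp : Fact p.Prime]
    (P : Sylow p G) (K : Subgroup G) [hK : K.Normal] (hKi : ∃ k, K.index = p ^ k)
    (hD : ((P : Subgroup G) ⊓ K).Normal)
    (hfr : ∀ M, IsMaximalSubgroupOf M (P : Subgroup G) → (P : Subgroup G) ⊓ K ≤ M) :
    IsPNilpotent p G := by
  set D := (P : Subgroup G) ⊓ K with hDdef
  have hDp : IsPGroup p D := P.2.to_le inf_le_left
  have hPfr : ∀ R : Subgroup G, R ≤ P → R ⊔ K = ⊤ → R = P := by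
    intro R hR hRK
    by_contra hne
    obtain ⟨M, hRM, hM⟩ := aux_exists_max R P (lt_of_le_of_ne hR hne)
    apply hM.1.not_ge
    intro x hx
    have hx' : x ∈ R ⊔ K := hRK ▸ Subgroup.mem_top x
    obtain ⟨r, hr, k, hk, rfl⟩ := Subgroup.mem_sup_of_normal_right.1 hx'
    refine M.mul_mem (hRM hr) (hfr M hM ⟨?_, hk⟩)
    have := mul_mem (inv_mem (hR hr)) hx
    rwa [inv_mul_cancel_left] at this
  -- conjugating a `p`-subgroup into `P`
  have hconj : ∀ S : Subgroup G, IsPGroup p S → ∃ g : G, MulAut.conj g • S ≤ P := by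
    intro S hS
    obtain ⟨P', hP'⟩ := hS.exists_le_sylow
    obtain ⟨g, hg⟩ := MulAction.exists_smul_eq G P' P
    refine ⟨g, ?_⟩
    rw [← hg, Sylow.coe_subgroup_smul]
    exact Subgroup.pointwise_smul_le_pointwise_smul_iff.2 hP'
  have hpK : ∀ S : Subgroup G, IsPGroup p S → S ≤ K → S ≤ D := by
    intro S hS hSK
    obtain ⟨g, hg⟩ := hconj S hS
    have h1 : MulAut.conj g • S ≤ D := by
      refine le_inf hg ?_
      rw [← Subgroup.Normal.conjAct hK (ConjAct.toConjAct g)]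
      exact Subgroup.pointwise_smul_le_pointwise_smul_iff.2 hSK
    intro x hx
    have h2 : g * x * g⁻¹ ∈ D := h1 (Subgroup.smul_mem_pointwise_smul x (MulAut.conj g) S hx)
    have := hD.conj_mem _ h2 g⁻¹
    simpa [mul_assoc] using this
  -- the centralizer of `D` has `p`-power index
  have hcent : ∀ q : ℕ, q.Prime → q ≠ p → ¬ q ∣ (Subgroup.centralizer (D : Set G)).index := by
    intro q hq hqp hdiv
    have : Fact q.Prime := ⟨hq⟩
    obtain ⟨Q⟩ : Nonempty (Sylow q K) := inferInstance
    have hfrat := Sylow.normalizer_sup_eq_top Q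
    set Q' := (Q : Subgroup K).map K.subtype with hQ'
    set N := Subgroup.normalizer (Q' : Set G) with hN
    obtain ⟨S⟩ : Nonempty (Sylow p N) := inferInstance
    let R := (S : Subgroup N).map N.subtype
    have hRp : IsPGroup p R := S.2.map _
    have hRN : R ≤ N := Subgroup.map_subtype_le _
    have hRK : R ⊔ K = ⊤ := by
      let φ : N →* G ⧸ K := (QuotientGroup.mk' K).comp N.subtype
      have hφ : Function.Surjective φ := by
        intro y
        obtain ⟨x, rfl⟩ := QuotientGroup.mk'_surjective K y
        have hx : x ∈ N ⊔ K := hfrat ▸ Subgroup.mem_top x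
        obtain ⟨n, hn, k, hk, rfl⟩ := Subgroup.mem_sup_of_normal_right.1 hx
        refine ⟨⟨n, hn⟩, ?_⟩
        show QuotientGroup.mk' K n = _
        rw [map_mul, (QuotientGroup.eq_one_iff (N := K) k).2 hk |> (fun h => (h : QuotientGroup.mk' K k = 1)), mul_one]
      have htop : IsPGroup p (⊤ : Subgroup (G ⧸ K)) := by
        obtain ⟨k, hk⟩ := hKi
        apply IsPGroup.of_card (n := k)
        rw [Subgroup.card_top, ← Subgroup.index_eq_card, hk]
      have h1 : ((S.mapSurjective hφ : Sylow p (G ⧸ K)) : Subgroup (G ⧸ K)) = ⊤ :=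
        ((S.mapSurjective hφ).3 htop le_top).symm
      rw [Sylow.coe_mapSurjective] at h1
      have h2 : R.map (QuotientGroup.mk' K) = ⊤ := by
        rw [Subgroup.map_map]; exact h1
      have h3 := congrArg (Subgroup.comap (QuotientGroup.mk' K)) h2
      rwa [Subgroup.comap_map_eq, QuotientGroup.ker_mk', Subgroup.comap_top] at h3
    have hDR : D ≤ R := by
      obtain ⟨g, hg⟩ := hconj R hRp
      have h1 : MulAut.conj g • R ⊔ K = ⊤ := by
        rw [← Subgroup.Normal.conjAct hK (ConjAct.toConjAct g)]
        have : MulAut.conj g • (R ⊔ K) = MulAut.conj g • (⊤ : Subgroup G) := by rw [hRK]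
        rw [Subgroup.smul_sup] at this
        refine Eq.trans this ?_
        exact Subgroup.Normal.conjAct (inferInstance : (⊤ : Subgroup G).Normal) (ConjAct.toConjAct g)
      have h2 := hPfr _ hg h1
      intro x hx
      have h3 : g * x * g⁻¹ ∈ MulAut.conj g • R := by
        rw [h2]; exact (hD.conj_mem x hx g).1
      exact (Subgroup.smul_mem_pointwise_smul_iff (a := MulAut.conj g)).1 h3
    have hdisj : Disjoint D Q' := IsPGroup.disjoint_of_ne p q hqp.symm D Q' hDp (Q.2.map _)
    have hQC : Q' ≤ Subgroup.centralizer (D : Set G) := by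
      intro x hx
      rw [Subgroup.mem_centralizer_iff_commutator_eq_one]
      intro d hd
      have hdN : d ∈ N := hRN (hDR hd)
      have h1 : d * x * d⁻¹ ∈ Q' := (Subgroup.mem_normalizer_iff.1 hdN x).1 hx
      have h2 : d * x * d⁻¹ * x⁻¹ ∈ Q' := mul_mem h1 (inv_mem hx)
      have h3 : d * x * d⁻¹ * x⁻¹ ∈ D := by
        rw [mul_assoc, mul_assoc, ← mul_assoc x]
        exact mul_mem hd (hD.conj_mem _ (inv_mem hd) x)
      exact (Subgroup.disjoint_def.1 hdisj) h3 h2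
    have h4 := hdiv.trans (Subgroup.index_dvd_of_le hQC)
    rw [hQ', Subgroup.index_map_subtype] at h4
    rcases hq.dvd_mul.1 h4 with h5 | h5
    · exact Q.not_dvd_index h5
    · obtain ⟨k, hk⟩ := hKi
      rw [hk] at h5
      exact hqp ((Nat.prime_dvd_prime_iff_eq hq hp.out).1 (hq.dvd_of_dvd_pow h5))
  have hci : ∃ k, (Subgroup.centralizer (D : Set G)).index = p ^ k := by
    refine ⟨_, Nat.eq_prime_pow_of_unique_prime_dvd Subgroup.FiniteIndex.index_ne_zero ?_⟩
    intro q hq hdiv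
    by_contra hne
    exact hcent q hq hne hdiv
  set C := Subgroup.centralizer (D : Set G) ⊓ K with hC
  have hCn : C.Normal := inferInstance
  apply aux_lift C
  · obtain ⟨k, hk⟩ := hKi
    obtain ⟨l, hl⟩ := hci
    have h1 : C.relIndex K ∣ p ^ l := by
      rw [hC, Subgroup.inf_relIndex_right, ← hl]
      exact Subgroup.relIndex_dvd_index_of_normal _ _
    obtain ⟨j, _, hj⟩ := (Nat.dvd_prime_pow hp.out).1 h1
    refine ⟨j + k, ?_⟩
    rw [← Subgroup.relIndex_mul_index (inf_le_right : C ≤ K), hj, hk, pow_add]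
  · obtain ⟨S⟩ : Nonempty (Sylow p C) := inferInstance
    apply aux_pnil_of_burnside S
    intro x _
    rw [Subgroup.mem_centralizer_iff]
    intro s hs
    have hSD : (S : Subgroup C).map C.subtype ≤ D :=
      hpK _ (S.2.map _) ((Subgroup.map_subtype_le _).trans inf_le_right)
    have hsD : (s : G) ∈ D := hSD ⟨s, hs, rfl⟩
    exact Subtype.ext (Subgroup.mem_centralizer_iff.1 x.2.1 s hsD)

theorem stmt2 {G : Type*} [Group G] [Fintype G] {p : ℕ}
    (hp : p.Prime) (hdvd : p ∣ Nat.card G)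
    (hmin : ∀ q : ℕ, q.Prime → q ∣ Nat.card G → p ≤ q)
    (P : Sylow p G)
    (h : ∀ M : Subgroup G, IsMaximalSubgroupOf M (P : Subgroup G) → M.IsCNormal) :
    IsPNilpotent p G := by
  have : Fact p.Prime := ⟨hp⟩
  -- the smallest normal subgroup of `p`-power index
  obtain ⟨K, ⟨hK, hKi⟩, hKmin⟩ := Set.Finite.exists_minimal
    (Set.toFinite {K : Subgroup G | K.Normal ∧ ∃ k, K.index = p ^ k})
    ⟨⊤, inferInstance, 0, by simp⟩
  have hle : ∀ L : Subgroup G, L.Normal → (∃ k, L.index = p ^ k) → K ≤ L := by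
    rintro L hL ⟨l, hl⟩
    have hmem : K ⊓ L ∈ {K : Subgroup G | K.Normal ∧ ∃ k, K.index = p ^ k} := by
      refine ⟨inferInstance, ?_⟩
      obtain ⟨k, hk⟩ := hKi
      have h1 : (K ⊓ L).relIndex K ∣ p ^ l := by
        rw [Subgroup.inf_relIndex_left, ← hl]
        exact Subgroup.relIndex_dvd_index_of_normal _ _
      obtain ⟨j, _, hj⟩ := (Nat.dvd_prime_pow hp).1 h1
      refine ⟨j + k, ?_⟩
      rw [← Subgroup.relIndex_mul_index (inf_le_left : K ⊓ L ≤ K), hj, hk, pow_add]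
    exact (hKmin hmem inf_le_left).trans inf_le_right
  have hPbot : (⊥ : Subgroup G) < P := bot_lt_iff_ne_bot.2 (P.ne_bot_of_dvd_card hdvd)
  obtain ⟨M₀, _, hM₀⟩ := aux_exists_max ⊥ (P : Subgroup G) hPbot
  apply aux_final P K hKi
  · obtain ⟨L, hL, hLi, hn, _⟩ := aux_key hmin P M₀ hM₀ (h M₀ hM₀)
    have : (P : Subgroup G) ⊓ K = ((P : Subgroup G) ⊓ L) ⊓ K := by
      rw [inf_assoc, inf_eq_right.2 (hle L hL hLi)]
    rw [this]
    infer_instance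
  · intro M hM
    obtain ⟨L, hL, hLi, _, hLM⟩ := aux_key hmin P M hM (h M hM)
    exact (inf_le_inf_left _ (hle L hL hLi)).trans hLM
end

section
/- Let G be a finite group. If for every prime p dividing |G| and every Sylow p-subgroup P of G, every maximal subgroup of P is c-normal in G, then G is supersoluble. -/
open scoped Pointwise

namespace CN

variable {G : Type*} [Group G]

/-- Conjugation action of a subgroup on an invariant set. -/
@[reducible] def conjAct (R : Subgroup G) (S : Set G)
    (hS : ∀ r ∈ R, ∀ x ∈ S, r * x * r⁻¹ ∈ S) : MulAction R S where
  smul r x := ⟨r * x * (r : G)⁻¹, hS r r.2 x x.2⟩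
  one_smul x := by
    apply Subtype.ext
    change ((1 : R) : G) * x * ((1 : R) : G)⁻¹ = x
    simp
  mul_smul a b x := by
    apply Subtype.ext
    change ((a * b : R) : G) * x * ((a * b : R) : G)⁻¹ = a * (b * x * (b : G)⁻¹) * (a : G)⁻¹
    push_cast
    group

theorem exists_fixed [Finite G] {q : ℕ} [Fact q.Prime] (R : Subgroup G) (hR : IsPGroup q R)
    (S : Set G) (hS : ∀ r ∈ R, ∀ x ∈ S, r * x * r⁻¹ ∈ S) (hq : ¬ q ∣ Nat.card S) :
    ∃ x ∈ S, ∀ r ∈ R, r * x * r⁻¹ = x := by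
  letI := conjAct R S hS
  obtain ⟨x, hx⟩ := hR.nonempty_fixed_point_of_prime_not_dvd_card S hq
  exact ⟨x, x.2, fun r hr => congrArg Subtype.val (hx ⟨r, hr⟩)⟩

theorem exists_fixed_ne_one [Finite G] {q : ℕ} [Fact q.Prime] (R : Subgroup G) (hR : IsPGroup q R)
    (N : Subgroup G) (hN : N.Normal) (hq : q ∣ Nat.card N) :
    ∃ x ∈ N, x ≠ 1 ∧ ∀ r ∈ R, r * x * r⁻¹ = x := by
  letI : MulAction R N := conjAct R (N : Set G) (fun r _ x hx => hN.conj_mem x hx r)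
  have h1 : (1 : N) ∈ MulAction.fixedPoints R N := by
    intro r
    apply Subtype.ext
    change (r : G) * ((1 : N) : G) * (r : G)⁻¹ = ((1 : N) : G)
    simp
  obtain ⟨x, hx, hne⟩ := hR.exists_fixed_point_of_prime_dvd_card_of_fixed_point N hq h1
  refine ⟨x, x.2, fun h => hne (Subtype.ext h.symm), fun r hr => ?_⟩
  exact congrArg Subtype.val (hx ⟨r, hr⟩)

theorem exists_max [Finite G] {D P : Subgroup G} (h : D < P) :
    ∃ M, IsMaximalSubgroupOf M P ∧ D ≤ M := by
  obtain ⟨M, hDM, hM⟩ := Finite.exists_le_maximal (p := fun K : Subgroup G => K < P) h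
  refine ⟨M, ⟨hM.1, fun K hMK hKP => ?_⟩, hDM⟩
  by_contra hne
  exact absurd (hM.2 (lt_of_le_of_ne hKP hne) hMK.le) (not_le_of_gt hMK)

/-- maximal subgroups have index p -/
theorem max_relIndex [Finite G] {p : ℕ} [hp : Fact p.Prime] {M P : Subgroup G} (hP : IsPGroup p P)
    (hM : IsMaximalSubgroupOf M P) : M.relIndex P = p := by
  have hle := hM.1.le
  obtain ⟨n, hn⟩ := IsPGroup.iff_card.mp (hP.to_le hle)
  obtain ⟨m, hm⟩ := IsPGroup.iff_card.mp hP
  have hmul : Nat.card M * M.relIndex P = Nat.card P := by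
    have := Subgroup.relIndex_mul_relIndex (H := ⊥) (K := M) (L := P) bot_le hle
    simpa using this
  have hlt : n < m := by
    have h1 : Nat.card M < Nat.card P := by
      refine lt_of_le_of_ne (Subgroup.card_le_of_le hle) fun h => ?_
      exact hM.1.ne (Subgroup.eq_of_le_of_card_ge hle h.ge)
    rw [hn, hm] at h1
    exact (Nat.pow_lt_pow_iff_right hp.1.one_lt).mp h1
  have hcard : Nat.card (M.subgroupOf P) = p ^ n := by
    rw [← hn]
    exact Nat.card_congr (Subgroup.subgroupOfEquivOfLe hle).toEquiv
  obtain ⟨K, hK, hMK⟩ := Sylow.exists_subgroup_card_pow_succ (G := P) (p := p) (n := n)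
    (by rw [hm]; exact pow_dvd_pow p hlt) hcard
  have hK' : Nat.card (K.map P.subtype) = p ^ (n + 1) := by
    rw [← hK]
    exact Subgroup.card_map_of_injective P.subtype_injective
  have hMK' : M ≤ K.map P.subtype := by
    have := Subgroup.map_mono (f := P.subtype) hMK
    rwa [Subgroup.subgroupOf_map_subtype, inf_eq_left.mpr hle] at this
  have := hM.2 (K.map P.subtype) (lt_of_le_of_ne hMK' fun h => by
    have : p ^ n = p ^ (n + 1) := by rw [← hn, ← hK', ← h]
    have := Nat.pow_right_injective hp.1.two_le this
    omega) (Subgroup.map_subtype_le K)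
  rw [this] at hK'
  rw [hn, hK', pow_succ] at hmul
  exact Nat.eq_of_mul_eq_mul_left (pow_pos hp.1.pos n) hmul

theorem relIndex_sup_normal [Finite G] (P N : Subgroup G) [N.Normal] :
    P.relIndex (P ⊔ N) = P.relIndex N := by
  have h1 := Subgroup.relIndex_sup_right P N
  have h2 : Nat.card N * N.relIndex (P ⊔ N) = Nat.card (P ⊔ N : Subgroup G) := by
    simpa using Subgroup.relIndex_mul_relIndex (H := ⊥) (K := N) (L := P ⊔ N) bot_le le_sup_right
  have h3 : Nat.card P * P.relIndex (P ⊔ N) = Nat.card (P ⊔ N : Subgroup G) := by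
    simpa using Subgroup.relIndex_mul_relIndex (H := ⊥) (K := P) (L := P ⊔ N) bot_le le_sup_left
  have h4 : Nat.card (P ⊓ N : Subgroup G) * P.relIndex N = Nat.card N := by
    have := Subgroup.relIndex_mul_relIndex (H := ⊥) (K := P ⊓ N) (L := N) bot_le inf_le_right
    rwa [Subgroup.relIndex_bot_left, Subgroup.relIndex_bot_left, Subgroup.inf_relIndex_right] at this
  have h5 : Nat.card (P ⊓ N : Subgroup G) * N.relIndex P = Nat.card P := by
    have := Subgroup.relIndex_mul_relIndex (H := ⊥) (K := P ⊓ N) (L := P) bot_le inf_le_left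
    rwa [Subgroup.relIndex_bot_left, Subgroup.relIndex_bot_left, Subgroup.inf_relIndex_left] at this
  have hpos : 0 < Nat.card P := Nat.card_pos
  apply Nat.eq_of_mul_eq_mul_left hpos
  rw [h3, ← h2, h1, ← h4, ← h5]
  ring

/-- `G ⧸ N` is supersolvable, expressed inside `G`. -/
inductive Red : Subgroup G → Prop
  | top : Red ⊤
  | step (N N' : Subgroup G) (hN : N.Normal) (hN' : N'.Normal) (hle : N ≤ N')
      (hp : (N.relIndex N').Prime) (h : Red N') : Red N

theorem Red.supersolvable {N : Subgroup G} (h : Red N) :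
    ∃ (n : ℕ) (c : ℕ → Subgroup G), c 0 = N ∧ c n = ⊤ ∧
    (∀ i, c i ≤ c (i + 1)) ∧ (∀ i, (c i).Normal) ∧
    ∀ i, ∃ x ∈ c (i + 1), c i ⊔ Subgroup.zpowers x = c (i + 1) := by
  induction h with
  | top => exact ⟨0, fun _ => ⊤, rfl, rfl, fun _ => le_rfl, fun _ => inferInstance,
      fun _ => ⟨1, trivial, by simp⟩⟩
  | step N N' hN hN' hle hp h ih =>
    obtain ⟨n, c, h0, hn, hmono, hnor, hcyc⟩ := ih
    refine ⟨n + 1, fun i => Nat.casesOn i N c, rfl, hn, ?_, ?_, ?_⟩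
    · rintro (_ | i)
      · simpa [h0] using hle
      · exact hmono i
    · rintro (_ | i)
      · exact hN
      · exact hnor i
    · rintro (_ | i)
      · have : ¬ N' ≤ N := fun hh => by
          rw [Subgroup.relIndex_eq_one.mpr hh] at hp
          exact Nat.not_prime_one hp
        obtain ⟨x, hx, hxN⟩ := SetLike.not_le_iff_exists.mp this
        refine ⟨x, by simpa [h0] using hx, ?_⟩
        simp only [h0]
        have hle2 : N ⊔ Subgroup.zpowers x ≤ N' := sup_le hle (by simpa using hx)
        have hmul := Subgroup.relIndex_mul_relIndex N (N ⊔ Subgroup.zpowers x) N' le_sup_left hle2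
        apply le_antisymm hle2
        rw [← Subgroup.relIndex_eq_one]
        rcases (Nat.dvd_prime hp).mp (Dvd.intro _ hmul) with h1 | h1
        · rw [Subgroup.relIndex_eq_one] at h1
          exact absurd (h1 (Subgroup.mem_sup_right (Subgroup.mem_zpowers x))) hxN
        · rw [h1] at hmul
          exact Nat.eq_of_mul_eq_mul_left hp.pos (by rw [hmul, mul_one])
      · exact hcyc i

theorem Red.comap {C : Subgroup G} [C.Normal] {K : Subgroup (G ⧸ C)} (h : Red K) :
    Red (K.comap (QuotientGroup.mk' C)) := by
  induction h with
  | top => rw [Subgroup.comap_top]; exact Red.top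
  | step N N' hN hN' hle hp h ih =>
    refine Red.step _ _ (hN.comap _) (hN'.comap _) (Subgroup.comap_mono hle) ?_ ih
    rwa [Subgroup.relIndex_comap, Subgroup.map_comap_eq_self_of_surjective
      (QuotientGroup.mk'_surjective C)]

theorem Red.of_quot {C : Subgroup G} [C.Normal] (h : Red (⊥ : Subgroup (G ⧸ C))) : Red C := by
  have := h.comap
  rwa [MonoidHom.comap_bot, QuotientGroup.ker_mk'] at this

/-- the hypothesis -/
def Hyp (G : Type*) [Group G] : Prop := ∀ p : ℕ, p.Prime → ∀ P : Sylow p G,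
      ∀ M : Subgroup G, IsMaximalSubgroupOf M (P : Subgroup G) → M.IsCNormal

theorem index_pow [Finite G] {q : ℕ} [Fact q.Prime] {M T : Subgroup G} (hM : IsPGroup q M)
    (hT : T.Normal) (h : (M : Set G) * (T : Set G) = Set.univ) : ∃ k, T.index = q ^ k := by
  have hsup : M ⊔ T = ⊤ := by
    apply SetLike.coe_injective
    rw [Subgroup.mul_normal, h]; rfl
  have := Subgroup.relIndex_sup_right M T
  rw [hsup, Subgroup.relIndex_top_right] at this
  rw [this]
  exact hM.index (T.subgroupOf M)

theorem Hyp.quot [Finite G] (h : Hyp G) {r : ℕ} [hr : Fact r.Prime] (N : Subgroup G) [hN : N.Normal]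
    (hNr : IsPGroup r N) : Hyp (G ⧸ N) := by
  intro q hq Q' M' hM'
  haveI := Fact.mk hq
  obtain ⟨Q, rfl⟩ := Sylow.mapSurjective_surjective (QuotientGroup.mk'_surjective N) q Q'
  rw [Sylow.coe_mapSurjective] at hM'
  set π := QuotientGroup.mk' N with hπ
  have hsurj : Function.Surjective π := QuotientGroup.mk'_surjective N
  set M : Subgroup G := (Q : Subgroup G) ⊓ M'.comap π with hMdef
  have hmap : M.map π = M' := by
    apply le_antisymm
    · rw [Subgroup.map_le_iff_le_comap]; exact inf_le_right
    · intro y hy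
      obtain ⟨x, hx, rfl⟩ := hM'.1.le hy
      exact ⟨x, ⟨hx, hy⟩, rfl⟩
  have hker : ∀ x, π x = 1 ↔ x ∈ N := fun x => by
    rw [← MonoidHom.mem_ker, QuotientGroup.ker_mk']
  have hMmax : IsMaximalSubgroupOf M (Q : Subgroup G) := by
    refine ⟨lt_of_le_of_ne inf_le_left fun hh => hM'.1.ne (by rw [← hmap, hh]), ?_⟩
    intro K hMK hKQ
    have h1 : M' ≤ K.map π := by rw [← hmap]; exact Subgroup.map_mono hMK.le
    have h2 : M' ≠ K.map π := fun hh => hMK.not_ge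
      (le_inf hKQ (by rw [← Subgroup.map_le_iff_le_comap, ← hh]))
    have h3 := hM'.2 _ (lt_of_le_of_ne h1 h2) (Subgroup.map_mono hKQ)
    apply le_antisymm hKQ
    intro x hx
    have : π x ∈ K.map π := by rw [h3]; exact ⟨x, hx, rfl⟩
    obtain ⟨k, hk, hkx⟩ := this
    have hn : k⁻¹ * x ∈ N := by rw [← hker, map_mul, map_inv, hkx]; simp
    have : k⁻¹ * x ∈ M := Subgroup.mem_inf.mpr ⟨mul_mem (inv_mem (hKQ hk)) hx, by
      rw [Subgroup.mem_comap, (hker _).mpr hn]; exact one_mem _⟩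
    have := mul_mem hk (hMK.le this)
    simpa using this
  obtain ⟨T, hT, hMT, hcore⟩ := h q hq Q M hMmax
  have hMq : IsPGroup q M := Q.2.to_le inf_le_left
  refine ⟨T.map π, hT.map π hsurj, ?_, ?_⟩
  · rw [← hmap]
    ext y
    simp only [Set.mem_univ, iff_true]
    obtain ⟨x, rfl⟩ := hsurj y
    have : x ∈ (M : Set G) * (T : Set G) := by rw [hMT]; trivial
    obtain ⟨m, hm, t, ht, rfl⟩ := this
    exact ⟨π m, ⟨m, hm, rfl⟩, π t, ⟨t, ht, rfl⟩, (map_mul _ _ _).symm⟩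
  · have hcore' : M.normalCore.map π ≤ M'.normalCore := by
      haveI : (M.normalCore.map π).Normal := (Subgroup.normalCore_normal M).map π hsurj
      rw [Subgroup.normal_le_normalCore, ← hmap]
      exact Subgroup.map_mono (Subgroup.normalCore_le M)
    refine le_trans ?_ hcore'
    rintro y ⟨hyM, t, ht, rfl⟩
    rw [← hmap] at hyM
    obtain ⟨m, hm, hmt⟩ := hyM
    have hn : m⁻¹ * t ∈ N := by rw [← hker, map_mul, map_inv, hmt]; simp
    by_cases hqr : q = r
    · subst hqr
      have hNQ : N ≤ Q := hNr.le_sylow_of_normal Q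
      have : m⁻¹ * t ∈ M := Subgroup.mem_inf.mpr ⟨hNQ hn, by
        rw [Subgroup.mem_comap, (hker _).mpr hn]; exact one_mem _⟩
      have : t ∈ M := by simpa using mul_mem hm this
      exact ⟨t, hcore ⟨this, ht⟩, rfl⟩
    · have hNT : N ≤ T := by
        obtain ⟨k, hk⟩ := index_pow hMq hT hMT
        obtain ⟨n, hn⟩ := IsPGroup.iff_card.mp hNr
        rw [← Subgroup.relIndex_eq_one]
        refine Nat.eq_one_of_dvd_coprimes ?_ (Subgroup.relIndex_dvd_index_of_normal T N)
          (Subgroup.relIndex_dvd_card T N)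
        rw [hk, hn]
        exact Nat.Coprime.pow _ _ ((Nat.coprime_primes hq hr.1).mpr hqr)
      have hmT : m ∈ T := by
        have := mul_mem ht (inv_mem (hNT hn))
        simpa using this
      exact ⟨m, hcore ⟨hm, hmT⟩, hmt⟩

/-- minimal normal subgroup -/
structure MinNormal (N : Subgroup G) : Prop where
  normal : N.Normal
  ne_bot : N ≠ ⊥
  min : ∀ K : Subgroup G, K.Normal → K ≤ N → K = ⊥ ∨ K = N

theorem exists_minNormal [Finite G] {L : Subgroup G} (hL : L.Normal) (hne : L ≠ ⊥) :
    ∃ N, MinNormal N ∧ N ≤ L := by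
  obtain ⟨N, hNL, hN⟩ := Finite.exists_le_minimal
    (p := fun K : Subgroup G => K.Normal ∧ K ≠ ⊥) (a := L) ⟨hL, hne⟩
  refine ⟨N, ⟨hN.1.1, hN.1.2, fun K hK hKN => ?_⟩, hNL⟩
  by_cases h : K = ⊥
  · exact Or.inl h
  · exact Or.inr (le_antisymm hKN (hN.2 ⟨hK, h⟩ hKN))

/-- Sylow subgroups cut normal subgroups in Sylow subgroups -/
theorem not_dvd_relIndex [Finite G] {p : ℕ} [Fact p.Prime] (P : Sylow p G) (N : Subgroup G)
    [N.Normal] : ¬ p ∣ (P : Subgroup G).relIndex N := by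
  rw [← relIndex_sup_normal]
  exact fun h => P.not_dvd_index (h.trans (Subgroup.relIndex_dvd_index_of_le le_sup_left))

theorem burnside_case [Finite G] {N : Subgroup G} (hN : MinNormal N) {p : ℕ} [hp : Fact p.Prime]
    (hpN : (Nat.card N).minFac = p) (S : Sylow p N) (hS : IsCyclic S) : IsCyclic N := by
  have hpd : p ∣ Nat.card N := hpN ▸ Nat.minFac_dvd _
  have hc := hS.isComplement' hpN
  set K := (MonoidHom.transferSylow S (hS.normalizer_le_centralizer hpN)).ker with hK
  haveI : K.Normal := MonoidHom.normal_ker _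
  haveI := hN.normal
  have hcop : Nat.Coprime K.index (Nat.card K) := by
    have h1 : K.index = Nat.card S := hc.symm.index_eq_card
    have h2 : (S : Subgroup N).index = Nat.card K := hc.index_eq_card
    rw [h1, ← h2]
    exact S.card_coprime_index
  have hchar : ∀ φ : N ≃* N, K.map φ.toMonoidHom ≤ K := by
    intro φ
    rw [← Subgroup.relIndex_eq_one]
    refine Nat.eq_one_of_dvd_coprimes hcop (Subgroup.relIndex_dvd_index_of_normal K _) ?_
    have : Nat.card (K.map φ.toMonoidHom) = Nat.card K :=
      Subgroup.card_map_of_injective φ.injective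
    rw [← this]
    exact Subgroup.relIndex_dvd_card K _
  have hnor : (K.map N.subtype).Normal := by
    constructor
    rintro _ ⟨k, hk, rfl⟩ g
    exact ⟨MulAut.conjNormal g k, hchar (MulAut.conjNormal g) ⟨k, hk, rfl⟩,
      by simp [MulAut.conjNormal_apply]⟩
  rcases hN.min _ hnor (Subgroup.map_subtype_le K) with h | h
  · rw [Subgroup.map_eq_bot_iff_of_injective _ N.subtype_injective] at h
    have h2 : (S : Subgroup N).index = Nat.card K := hc.index_eq_card
    rw [h, Subgroup.card_bot, Subgroup.index_eq_one] at h2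
    have e : S ≃* N := (MulEquiv.subgroupCongr h2).trans Subgroup.topEquiv
    exact e.isCyclic.mp hS
  · exfalso
    have hKtop : K = ⊤ := by
      apply Subgroup.map_injective N.subtype_injective
      rw [h, ← MonoidHom.range_eq_map, Subgroup.range_subtype]
    have h1 : K.index = Nat.card S := hc.symm.index_eq_card
    rw [hKtop, Subgroup.index_top] at h1
    have := S.dvd_card_of_dvd_card hpd
    rw [← h1] at this
    exact hp.1.one_lt.ne' (Nat.dvd_one.mp this)

/-- a nontrivial cyclic normal subgroup -/
def HasCyc (G : Type*) [Group G] : Prop := ∃ x : G, x ≠ 1 ∧ ∀ g : G, g * x * g⁻¹ ∈ Subgroup.zpowers x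

theorem lemA [Finite G] (h : Hyp G) {N : Subgroup G} (hN : MinNormal N) {p : ℕ} [hp : Fact p.Prime]
    (hpN : (Nat.card N).minFac = p) (P : Sylow p G) (hno : ¬ HasCyc G) :
    ∀ M, IsMaximalSubgroupOf M (P : Subgroup G) → N ≤ M := by
  intro M hM
  by_contra hNM
  apply hno
  have hpd : p ∣ Nat.card N := hpN ▸ Nat.minFac_dvd _
  haveI := hN.normal
  obtain ⟨T, hT, hMT, hcore⟩ := h p hp.1 P M hM
  have hMp : IsPGroup p M := P.2.to_le hM.1.le
  have hcN : M.normalCore ⊓ N = ⊥ := by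
    refine (hN.min _ inferInstance inf_le_right).resolve_right fun hh => hNM ?_
    rw [← hh]
    exact inf_le_left.trans (Subgroup.normalCore_le M)
  rcases hN.min (T ⊓ N) inferInstance inf_le_right with hTN | hTN
  · obtain ⟨x, hxN, hx1, hx⟩ := exists_fixed_ne_one M hMp N hN.normal hpd
    refine ⟨x, hx1, fun g => ?_⟩
    have hg : g ∈ (M : Set G) * (T : Set G) := by rw [hMT]; trivial
    obtain ⟨m, hm, t, ht, rfl⟩ := hg
    have hcom : t * x * t⁻¹ * x⁻¹ ∈ T ⊓ N := by
      refine Subgroup.mem_inf.mpr ⟨?_, mul_mem (hN.normal.conj_mem x hxN t) (inv_mem hxN)⟩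
      have : t * x * t⁻¹ * x⁻¹ = t * (x * t⁻¹ * x⁻¹) := by group
      rw [this]
      exact mul_mem ht (hT.conj_mem _ (inv_mem ht) x)
    rw [hTN, Subgroup.mem_bot, mul_inv_eq_one] at hcom
    have : m * t * x * (m * t)⁻¹ = m * (t * x * t⁻¹) * m⁻¹ := by group
    change m * t * x * (m * t)⁻¹ ∈ _
    rw [this, hcom, hx m hm]
    exact Subgroup.mem_zpowers x
  · have hNT : N ≤ T := inf_eq_right.mp hTN
    have hMN : M ⊓ N = ⊥ := by
      rw [eq_bot_iff, ← hcN]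
      exact le_inf ((inf_le_inf_left M hNT).trans hcore) inf_le_right
    have hPN : Nat.card ((P : Subgroup G) ⊓ N : Subgroup G) ≤ p := by
      have h1 : M.relIndex ((P : Subgroup G) ⊓ N) = Nat.card ((P : Subgroup G) ⊓ N : Subgroup G) := by
        rw [← Subgroup.inf_relIndex_right, ← Subgroup.relIndex_bot_left]
        congr 1
        rw [eq_bot_iff, ← hMN]
        exact inf_le_inf_left M inf_le_right
      rw [← h1]
      refine le_trans ?_ (max_relIndex P.2 hM).le
      apply Subgroup.relIndex_le_of_le_right inf_le_left
      rw [max_relIndex P.2 hM]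
      exact hp.1.ne_zero
    let S : Sylow p N := IsPGroup.toSylow (P := (P : Subgroup G).subgroupOf N)
      (P.2.comap_subtype) (not_dvd_relIndex P N)
    have hcS : Nat.card S = Nat.card ((P : Subgroup G) ⊓ N : Subgroup G) := by
      rw [← Subgroup.subgroupOf_map_subtype, Subgroup.card_map_of_injective N.subtype_injective]
      rfl
    have hpS := S.dvd_card_of_dvd_card hpd
    have hcSp : Nat.card S = p :=
      le_antisymm (hcS ▸ hPN) (Nat.le_of_dvd Nat.card_pos hpS)
    have hcyc := burnside_case hN hpN S (isCyclic_of_prime_card hcSp)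
    obtain ⟨x, hx⟩ := hcyc.exists_generator
    refine ⟨x, fun h1 => hN.ne_bot ?_, fun g => ?_⟩
    · rw [eq_bot_iff]
      intro y hy
      obtain ⟨k, hk⟩ := hx ⟨y, hy⟩
      have := congrArg Subtype.val hk
      simp [h1] at this
      simp [← this]
    · obtain ⟨k, hk⟩ := hx ⟨_, hN.normal.conj_mem x x.2 g⟩
      exact ⟨k, by simpa using congrArg Subtype.val hk⟩

/-- largest prime -/
theorem sylow_sup_normal [Finite G] {q : ℕ} [hq : Fact q.Prime]
    (hmax : ∀ r : ℕ, r.Prime → r ∣ Nat.card G → r ≤ q) (Q : Sylow q G) {N : Subgroup G}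
    (h : Red N) : ((Q : Subgroup G) ⊔ N).Normal := by
  induction h with
  | top => rw [sup_top_eq]; infer_instance
  | step N N' hN hN' hle hp h ih =>
    set S := (Q : Subgroup G) ⊔ N with hS
    have hr : N.relIndex N' ≤ q :=
      hmax _ hp ((Subgroup.relIndex_dvd_card N N').trans (Subgroup.card_subgroup_dvd_card N'))
    have key : ∀ g : G, S ≤ S.map (MulAut.conj g).toMonoidHom := by
      intro g
      set S' := S.map (MulAut.conj g).toMonoidHom with hS'
      have hNmap : ∀ K : Subgroup G, K.Normal → K.map (MulAut.conj g).toMonoidHom = K := by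
        intro K hK
        apply Subgroup.Normal.map_conj_eq
      have hNS' : N ≤ S' := by
        rw [← hNmap N hN]; exact Subgroup.map_mono le_sup_right
      have hL : S' ⊔ N' = (Q : Subgroup G) ⊔ N' := by
        have e : S ⊔ N' = (Q : Subgroup G) ⊔ N' := by
          rw [hS, sup_assoc, sup_eq_right.mpr hle]
        have := hNmap _ ih
        rw [← e, Subgroup.map_sup, hNmap N' hN', e] at this
        exact this
      have hd : S'.relIndex (S' ⊔ N') ∣ N.relIndex N' := by
        rw [relIndex_sup_normal]
        exact Subgroup.relIndex_dvd_of_le_left N' hNS'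
      have hndvd : ¬ q ∣ S'.index := by
        have : S'.index = S.index := Subgroup.index_map_equiv S (MulAut.conj g)
        rw [this]
        exact fun h => Q.not_dvd_index (h.trans (Subgroup.index_dvd_of_le le_sup_left))
      have hlt : S'.relIndex (S' ⊔ N') < q := by
        refine lt_of_le_of_ne ((Nat.le_of_dvd hp.pos hd).trans hr) fun he => hndvd ?_
        rw [← he]
        exact Subgroup.relIndex_dvd_index_of_le le_sup_left
      have hQ : S'.relIndex Q < q := by
        refine lt_of_le_of_lt (Subgroup.relIndex_le_of_le_right ?_ ?_) hlt
        · rw [hL]; exact le_sup_left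
        · exact ne_zero_of_dvd_ne_zero hp.ne_zero hd
      obtain ⟨k, hk⟩ := Q.2.index (S'.subgroupOf Q)
      change S'.relIndex Q = q ^ k at hk
      have hQS : (Q : Subgroup G) ≤ S' := by
        rw [← Subgroup.relIndex_eq_one, hk]
        rcases k with _ | k
        · simp
        · rw [hk] at hQ
          exact absurd (Nat.le_self_pow (Nat.succ_ne_zero k) q) (not_le_of_gt hQ)
      exact sup_le hQS hNS'
    constructor
    intro n hn g
    obtain ⟨m, hm, hmn⟩ := key g⁻¹ hn
    have : g * n * g⁻¹ = m := by
      rw [← hmn]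
      change g * (g⁻¹ * m * g⁻¹⁻¹) * g⁻¹ = m
      group
    rw [this]; exact hm

theorem sylow_normal [Finite G] {p q : ℕ} [Fact p.Prime] [Fact q.Prime]
    (hmax : ∀ r : ℕ, r.Prime → r ∣ Nat.card G → r ≤ q) (Q : Sylow q G) (P : Sylow p G)
    {N : Subgroup G} (hN : N.Normal) (hNP : N ≤ P)
    (hM : ∀ M, IsMaximalSubgroupOf M (P : Subgroup G) → N ≤ M)
    (h : Red N) : (Q : Subgroup G).Normal := by
  have hnor := sylow_sup_normal hmax Q h
  have hF : Subgroup.normalizer (Q : Set G) ⊔ ((Q : Subgroup G) ⊔ N) = ⊤ :=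
    Sylow.normalizer_sup_eq_top' Q le_sup_left
  set R := Subgroup.normalizer (Q : Set G) with hR
  have hQR : (Q : Subgroup G) ≤ R := Subgroup.le_normalizer
  rw [← sup_assoc, sup_eq_left.mpr hQR] at hF
  have hPR : (P : Subgroup G) ≤ R := by
    by_contra hPR
    have hlt : (P : Subgroup G) ⊓ R < P := lt_of_le_of_ne inf_le_left fun e => hPR (inf_eq_left.mp e)
    obtain ⟨M, hMm, hle⟩ := exists_max hlt
    apply hMm.1.not_ge
    intro x hx
    have : x ∈ R ⊔ N := by rw [hF]; trivial
    rw [Subgroup.mem_sup_of_normal_right] at this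
    obtain ⟨y, hy, z, hz, rfl⟩ := this
    have hy' : y ∈ (P : Subgroup G) := by
      have := mul_mem hx (inv_mem (hNP hz))
      simpa using this
    exact mul_mem (hle ⟨hy', hy⟩) (hM M hMm hz)
  have : R = ⊤ := by
    rw [← hF, sup_eq_left.mpr (hNP.trans hPR)]
  exact Subgroup.normalizer_eq_top_iff.mp this

theorem exists_eigen {V : Type*} [CommGroup V] [Finite V] [Nontrivial V] {p : ℕ} [hp : Fact p.Prime]
    (hV : ∀ v : V, v ^ p = 1) (φ : V →* V) (hφ : ∀ v, φ^[p] v = φ v) :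
    ∃ v : V, v ≠ 1 ∧ ∃ k : ℕ, φ v = v ^ k := by
  let W := Additive V
  letI : Module (ZMod p) W := AddCommGroup.zmodModule (n := p) (fun x => hV x.toMul)
  let f : Module.End (ZMod p) W := AddMonoidHom.toZModLinearMap p (MonoidHom.toAdditive φ)
  have hf : ∀ w : W, f w = Additive.ofMul (φ w.toMul) := fun w => rfl
  have hfn : ∀ n : ℕ, ∀ w : W, (f ^ n) w = Additive.ofMul (φ^[n] w.toMul) := by
    intro n
    induction n with
    | zero => intro w; simp
    | succ n ih =>
      intro w
      rw [pow_succ', Function.iterate_succ_apply']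
      change f ((f ^ n) w) = _
      rw [hf, ih]
      rfl
  have hfp : f ^ p = f := by
    ext w
    rw [hfn, hφ, hf]
  haveI : Finite W := inferInstanceAs (Finite V)
  haveI : Nontrivial W := inferInstanceAs (Nontrivial V)
  haveI : Module.Finite (ZMod p) W := inferInstance
  have hdvd : minpoly (ZMod p) f ∣ (Polynomial.X ^ p - Polynomial.X : Polynomial (ZMod p)) := by
    apply minpoly.dvd
    simp [hfp]
  have hint : IsIntegral (ZMod p) f := Algebra.IsIntegral.isIntegral f
  have hne : (Polynomial.X ^ p - Polynomial.X : Polynomial (ZMod p)) ≠ 0 :=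
    FiniteField.X_pow_card_sub_X_ne_zero _ hp.1.one_lt
  have hsplit : (Polynomial.X ^ p - Polynomial.X : Polynomial (ZMod p)).Splits := by
    rw [Polynomial.splits_iff_card_roots]
    have h1 := FiniteField.roots_X_pow_card_sub_X (ZMod p)
    rw [ZMod.card] at h1
    rw [h1, FiniteField.X_pow_card_sub_X_natDegree_eq _ hp.1.one_lt]
    change Fintype.card (ZMod p) = p
    exact ZMod.card p
  have hs2 := hsplit.of_dvd hne hdvd
  obtain ⟨μ, hμ⟩ := hs2.exists_eval_eq_zero (minpoly.degree_pos hint).ne'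
  have hE := Module.End.hasEigenvalue_of_isRoot (f := f) (μ := μ) hμ
  obtain ⟨w, hw⟩ := hE.exists_hasEigenvector
  refine ⟨w.toMul, hw.2, μ.val, ?_⟩
  have h1 : f w = μ • w := hw.apply_eq_smul
  have h2 : μ • w = μ.val • w := by
    conv_lhs => rw [← ZMod.natCast_zmod_val μ]
    exact Nat.cast_smul_eq_nsmul (ZMod p) μ.val w
  rw [h2] at h1
  exact h1

/-- `w` acts trivially on all normal sections of order `p`. -/
def Good (p : ℕ) (w : G) : Prop := ∀ K K' : Subgroup G, K.Normal → K'.Normal →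
  K.relIndex K' = p → ∀ y ∈ K', w * y * w⁻¹ * y⁻¹ ∈ K

theorem good_of_hom {p : ℕ} [hp : Fact p.Prime] (w : G)
    (hw : ∀ ψ : G →* (ZMod p)ˣ, ψ w = 1) : Good p w := by
  intro K K' hK hK' hrel y hy
  set π := QuotientGroup.mk' K with hπ
  have hsurj : Function.Surjective π := QuotientGroup.mk'_surjective K
  haveI : (K'.map π).Normal := hK'.map π hsurj
  have hcard : Nat.card (K'.map π) = p := by
    rw [← hrel, ← Subgroup.relIndex_bot_left, ← Subgroup.relIndex_comap, MonoidHom.comap_bot,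
      QuotientGroup.ker_mk']
  haveI : IsCyclic (K'.map π) := isCyclic_of_prime_card hcard
  let e := IsCyclic.mulAutMulEquiv (K'.map π)
  have hψ : ∀ φ : G →* MulAut (K'.map π), φ w = 1 := by
    intro φ
    have h1 : ∀ n : ℕ, n = p → ∀ e : MulAut (K'.map π) ≃* (ZMod n)ˣ, φ w = 1 := by
      rintro n rfl e
      exact e.map_eq_one_iff.mp (hw (e.toMonoidHom.comp φ))
    exact h1 _ hcard e
  have h := hψ ((MulAut.conjNormal (H := K'.map π)).comp π)
  have h2 := congrArg Subtype.val (DFunLike.congr_fun h ⟨π y, ⟨y, hy, rfl⟩⟩)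
  have h3 : π w * π y * (π w)⁻¹ = π y := h2
  rw [← QuotientGroup.ker_mk' K, MonoidHom.mem_ker]
  change π _ = 1
  rw [map_mul, map_mul, map_mul, map_inv, map_inv, h3, mul_inv_cancel]

theorem good_comm {p : ℕ} [hp : Fact p.Prime] (g h : G) : Good p (g * h * g⁻¹ * h⁻¹) := by
  apply good_of_hom
  intro ψ
  simp only [map_mul, map_inv]
  rw [mul_right_comm (ψ g)]
  simp

theorem good_pow {p : ℕ} [hp : Fact p.Prime] (g : G) : Good p (g ^ (p - 1)) := by
  apply good_of_hom
  intro ψ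
  rw [map_pow]
  exact ZMod.units_pow_card_sub_one_eq_one p _

theorem Good.zpowers {p : ℕ} {w : G} (h : Good p w) : ∀ v ∈ Subgroup.zpowers w, Good p v := by
  let X : Subgroup G :=
    { carrier := {v | Good p v}
      one_mem' := by
        intro K K' hK hK' hrel y hy
        simp
      mul_mem' := by
        intro a b ha hb K K' hK hK' hrel y hy
        have e : a * b * y * (a * b)⁻¹ * y⁻¹ =
            (a * (b * y * b⁻¹ * y⁻¹) * a⁻¹) * (a * y * a⁻¹ * y⁻¹) := by group
        rw [e]
        exact mul_mem (hK.conj_mem _ (hb K K' hK hK' hrel y hy) a) (ha K K' hK hK' hrel y hy)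
      inv_mem' := by
        intro a ha K K' hK hK' hrel y hy
        have e : a⁻¹ * y * a⁻¹⁻¹ * y⁻¹ = a⁻¹ * (a * y * a⁻¹ * y⁻¹)⁻¹ * a⁻¹⁻¹ := by group
        rw [e]
        exact hK.conj_mem _ (inv_mem (ha K K' hK hK' hrel y hy)) a⁻¹ }
  have hX : Subgroup.zpowers w ≤ X := Subgroup.zpowers_le.mpr h
  exact fun v hv => hX hv

theorem exists_fixed_mod [Finite G] {p q : ℕ} [hp : Fact p.Prime] [hq : Fact q.Prime] (hpq : q ≠ p)
    {P : Subgroup G} (hP : IsPGroup p P) (hPn : P.Normal) (R : Subgroup G) (hR : IsPGroup q R)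
    (hgood : ∀ r ∈ R, Good p r) {N : Subgroup G} (h : Red N) :
    ∀ x ∈ P, ∃ c ∈ P, (∀ r ∈ R, r * c * r⁻¹ = c) ∧ c⁻¹ * x ∈ N := by
  induction h with
  | top => exact fun x _ => ⟨1, one_mem _, by simp, trivial⟩
  | step N N' hN hN' hle hr h ih =>
    intro x hx
    obtain ⟨c, hc, hcR, hcx⟩ := ih x hx
    have hyP : c⁻¹ * x ∈ P := mul_mem (inv_mem hc) hx
    by_cases hrp : N.relIndex N' = p
    · set y := c⁻¹ * x with hy
      let S : Set G := {z | y⁻¹ * z ∈ N ⊓ P}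
      have hcard : Nat.card S = Nat.card (N ⊓ P : Subgroup G) := by
        refine Nat.card_congr ⟨fun z => ⟨y⁻¹ * z, z.2⟩, fun z => ⟨y * z, ?_⟩, ?_, ?_⟩
        · change y⁻¹ * (y * z) ∈ N ⊓ P
          rw [inv_mul_cancel_left]; exact z.2
        · intro z; simp
        · intro z; simp
      have hnd : ¬ q ∣ Nat.card S := by
        rw [hcard]
        obtain ⟨n, hn⟩ := IsPGroup.iff_card.mp (hP.to_le (inf_le_right : N ⊓ P ≤ P))
        rw [hn]
        intro hd
        exact hpq ((Nat.prime_dvd_prime_iff_eq hq.1 hp.1).mp (hq.1.dvd_of_dvd_pow hd))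
      obtain ⟨z, hz, hzR⟩ := exists_fixed R hR S (by
        intro r hr z hz
        change y⁻¹ * (r * z * r⁻¹) ∈ N ⊓ P
        have e : y⁻¹ * (r * z * r⁻¹) = (y⁻¹ * (r * y * r⁻¹)) * (r * (y⁻¹ * z) * r⁻¹) := by group
        rw [e]
        refine mul_mem (Subgroup.mem_inf.mpr ⟨?_, ?_⟩)
          ((inferInstance : (N ⊓ P).Normal).conj_mem _ hz r)
        · have := hN.conj_mem _ (hgood r hr N N' hN hN' hrp y hcx) y⁻¹
          have e2 : y⁻¹ * (r * y * r⁻¹ * y⁻¹) * y⁻¹⁻¹ = y⁻¹ * (r * y * r⁻¹) := by group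
          rwa [e2] at this
        · exact mul_mem (inv_mem hyP) (hPn.conj_mem _ hyP r)) hnd
      have hz' : y⁻¹ * z ∈ N ⊓ P := hz
      have hzP : z ∈ P := by
        have := mul_mem hyP (Subgroup.mem_inf.mp hz').2
        simpa using this
      refine ⟨c * z, mul_mem hc hzP, fun r hr => ?_, ?_⟩
      · have : r * (c * z) * r⁻¹ = (r * c * r⁻¹) * (r * z * r⁻¹) := by group
        rw [this, hcR r hr, hzR r hr]
      · have := inv_mem (Subgroup.mem_inf.mp hz').1
        have e : (c * z)⁻¹ * x = (y⁻¹ * z)⁻¹ := by rw [hy]; group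
        rwa [e]
    · refine ⟨c, hc, hcR, ?_⟩
      set y := c⁻¹ * x with hy
      have h1 : y ^ (N.relIndex N') ∈ N := by
        haveI : (N.subgroupOf N').Normal := inferInstance
        exact Subgroup.pow_index_mem (N.subgroupOf N') (⟨y, hcx⟩ : N')
      obtain ⟨k, hk⟩ := isPGroup_iff_pow_pow_eq_one.mp hP ⟨y, hyP⟩
      have hk' : y ^ p ^ k = 1 := congrArg Subtype.val hk
      have h2 : (QuotientGroup.mk' N y) = 1 := by
        rw [← orderOf_eq_one_iff]
        refine Nat.eq_one_of_dvd_coprimes (a := N.relIndex N') (b := p ^ k) ?_ ?_ ?_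
        · exact Nat.Coprime.pow_right _ ((Nat.coprime_primes hr hp.1).mpr hrp)
        · rw [orderOf_dvd_iff_pow_eq_one, ← map_pow, ← MonoidHom.mem_ker, QuotientGroup.ker_mk']
          exact h1
        · rw [orderOf_dvd_iff_pow_eq_one, ← map_pow, hk', map_one]
      rwa [← MonoidHom.mem_ker, QuotientGroup.ker_mk'] at h2

theorem good_centralizes [Finite G] {p : ℕ} [hp : Fact p.Prime] (P : Sylow p G)
    (hPn : (P : Subgroup G).Normal) {N : Subgroup G} (hNP : N ≤ P)
    (hPN : (P : Subgroup G) ≤ Subgroup.centralizer (N : Set G))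
    (hM : ∀ M, IsMaximalSubgroupOf M (P : Subgroup G) → N ≤ M) (hred : Red N)
    {w : G} (hw : Good p w) : w ∈ Subgroup.centralizer (N : Set G) := by
  set C := Subgroup.centralizer (N : Set G) with hC
  suffices h : Subgroup.zpowers w ≤ C from h (Subgroup.mem_zpowers w)
  set W := Subgroup.zpowers w with hW
  rw [← Subgroup.relIndex_eq_one]
  by_contra hne
  obtain ⟨q, hq, hqd⟩ := Nat.exists_prime_and_dvd hne
  haveI := Fact.mk hq
  let S : Sylow q W := default
  set R := (S : Subgroup W).map W.subtype with hRdef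
  have hR : IsPGroup q R := S.2.map _
  have hRW : R ≤ W := Subgroup.map_subtype_le _
  have hRC : R ≤ C := by
    by_cases hqp : q = p
    · subst hqp
      obtain ⟨Q, hQ⟩ := hR.exists_le_sylow
      obtain ⟨g, hg⟩ := MulAction.exists_smul_eq G P Q
      rw [Sylow.smul_eq_of_normal] at hg
      rw [← hg] at hQ
      exact hQ.trans hPN
    · have hfix := exists_fixed_mod hqp P.2 hPn R hR (fun r hr => hw.zpowers r (hRW hr)) hred
      have hPR : (P : Subgroup G) ≤ Subgroup.centralizer (R : Set G) := by
        by_contra hcon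
        have hlt : (P : Subgroup G) ⊓ Subgroup.centralizer (R : Set G) < P :=
          lt_of_le_of_ne inf_le_left fun e => hcon (inf_eq_left.mp e)
        obtain ⟨M, hMm, hle⟩ := exists_max hlt
        apply hMm.1.not_ge
        intro x hx
        obtain ⟨c, hc, hcR, hcx⟩ := hfix x hx
        have hcM : c ∈ M := hle (Subgroup.mem_inf.mpr ⟨hc, Subgroup.mem_centralizer_iff.mpr
          fun r hr => mul_inv_eq_iff_eq_mul.mp (hcR r hr)⟩)
        have := mul_mem hcM (hM M hMm hcx)
        simpa using this
      intro r hr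
      rw [hC, Subgroup.mem_centralizer_iff]
      intro n hn
      exact (Subgroup.mem_centralizer_iff.mp (hPR (hNP hn)) r hr).symm
  have hSC : (S : Subgroup W) ≤ C.subgroupOf W := by
    intro s hs
    exact hRC ⟨s, hs, rfl⟩
  exact S.not_dvd_index (hqd.trans (Subgroup.index_dvd_of_le hSC))

theorem lemB [Finite G] {p : ℕ} [hp : Fact p.Prime] (P : Sylow p G)
    (hPn : (P : Subgroup G).Normal) {N : Subgroup G} (hN : MinNormal N) (hNP : N ≤ P)
    (hM : ∀ M, IsMaximalSubgroupOf M (P : Subgroup G) → N ≤ M) (hred : Red N) : HasCyc G := by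
  haveI := hN.normal
  have hNp : IsPGroup p N := P.2.to_le hNP
  haveI hnt : Nontrivial N := (Subgroup.nontrivial_iff_ne_bot N).mpr hN.ne_bot
  have hpd : p ∣ Nat.card N := hNp.card_eq_or_dvd.resolve_left
    (fun h => hN.ne_bot (Subgroup.card_eq_one.mp h))
  have hNcP : N ≤ Subgroup.centralizer ((P : Subgroup G) : Set G) := by
    obtain ⟨x, hxN, hx1, hx⟩ := exists_fixed_ne_one (P : Subgroup G) P.2 N hN.normal hpd
    rcases hN.min (Subgroup.centralizer ((P : Subgroup G) : Set G) ⊓ N) inferInstance inf_le_right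
      with h | h
    · exfalso
      apply hx1
      rw [← Subgroup.mem_bot, ← h]
      exact Subgroup.mem_inf.mpr ⟨Subgroup.mem_centralizer_iff.mpr
          fun r hr => mul_inv_eq_iff_eq_mul.mp (hx r hr), hxN⟩
    · exact inf_eq_right.mp h
  have hPN : (P : Subgroup G) ≤ Subgroup.centralizer (N : Set G) :=
    Subgroup.le_centralizer_iff.mp hNcP
  have hgood : ∀ w : G, Good p w → ∀ n ∈ N, w * n * w⁻¹ = n := by
    intro w hw n hn
    have := Subgroup.mem_centralizer_iff.mp (good_centralizes P hPn hNP hPN hM hred hw) n hn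
    rw [← this, mul_inv_cancel_right]
  have hcomm : ∀ a ∈ N, ∀ b ∈ N, a * b = b * a := fun a ha b hb =>
    (Subgroup.mem_centralizer_iff.mp (hNcP ha) b (hNP hb)).symm
  letI : CommGroup N :=
    { (inferInstance : Group N) with mul_comm := fun a b => Subtype.ext (hcomm a a.2 b b.2) }
  -- exponent p
  have hexp : ∀ n ∈ N, n ^ p = 1 := by
    let E : Subgroup G :=
      { carrier := {n | n ∈ N ∧ n ^ p = 1}
        one_mem' := ⟨one_mem _, one_pow _⟩
        mul_mem' := fun {a b} ha hb => ⟨mul_mem ha.1 hb.1, by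
          rw [(show Commute a b from hcomm a ha.1 b hb.1).mul_pow, ha.2, hb.2, one_mul]⟩
        inv_mem' := fun {a} ha => ⟨inv_mem ha.1, by rw [inv_pow, ha.2, inv_one]⟩ }
    have hE : E.Normal := ⟨fun n hn g => ⟨hN.normal.conj_mem n hn.1 g, by
      rw [conj_pow, hn.2]; simp⟩⟩
    rcases hN.min E hE (fun x hx => hx.1) with h | h
    · exfalso
      obtain ⟨x, hx⟩ := exists_prime_orderOf_dvd_card' p hpd
      have hxE : (x : G) ∈ E := ⟨x.2, by
        have := pow_orderOf_eq_one x
        rw [hx] at this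
        exact_mod_cast congrArg Subtype.val this⟩
      rw [h, Subgroup.mem_bot] at hxE
      have : x = 1 := Subtype.ext hxE
      rw [this, orderOf_one] at hx
      exact hp.1.one_lt.ne hx
    · intro n hn
      rw [← h] at hn
      exact hn.2
  have hscal : ∀ g : G, ∃ k : ℕ, ∀ n ∈ N, g * n * g⁻¹ = n ^ k := by
    intro g
    let φ : N →* N := (MulAut.conjNormal g : MulAut N).toMonoidHom
    have hφ : ∀ n : N, ((φ n : N) : G) = g * n * g⁻¹ := fun n => rfl
    have hφn : ∀ m : ℕ, ∀ n : N, ((φ^[m] n : N) : G) = g ^ m * n * (g ^ m)⁻¹ := by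
      intro m
      induction m with
      | zero => intro n; simp
      | succ m ih =>
        intro n
        rw [Function.iterate_succ_apply', hφ, ih, pow_succ']
        group
    obtain ⟨v, hv1, k, hk⟩ := exists_eigen (V := N) (p := p)
      (fun v => Subtype.ext (by exact_mod_cast hexp v v.2)) φ (by
        intro v
        obtain ⟨m, hm⟩ : ∃ m, p = m + 1 := ⟨p - 1, (Nat.sub_add_cancel hp.1.one_le).symm⟩
        apply Subtype.ext
        have := hgood (g ^ (p - 1)) (good_pow g) v v.2
        have hpm : p - 1 = m := by omega
        rw [hpm] at this
        rw [hφn, hφ, hm, pow_succ']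
        have e : g * g ^ m * (v : G) * (g * g ^ m)⁻¹ = g * (g ^ m * v * (g ^ m)⁻¹) * g⁻¹ := by group
        rw [e, this])
    refine ⟨k, ?_⟩
    let E : Subgroup G :=
      { carrier := {n | n ∈ N ∧ g * n * g⁻¹ = n ^ k}
        one_mem' := ⟨one_mem _, by simp⟩
        mul_mem' := fun {a b} ha hb => ⟨mul_mem ha.1 hb.1, by
          rw [(show Commute a b from hcomm a ha.1 b hb.1).mul_pow, ← ha.2, ← hb.2]; group⟩
        inv_mem' := fun {a} ha => ⟨inv_mem ha.1, by rw [inv_pow, ← ha.2]; group⟩ }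
    have hE : E.Normal := by
      refine ⟨fun n hn h => ⟨hN.normal.conj_mem n hn.1 h, ?_⟩⟩
      have h1 : h * (g * n * g⁻¹) * h⁻¹ ∈ N :=
        hN.normal.conj_mem _ (hN.normal.conj_mem n hn.1 g) h
      have h2 := hgood _ (good_comm g h) _ h1
      rw [conj_pow, ← hn.2, ← h2]
      group
    rcases hN.min E hE (fun x hx => hx.1) with h | h
    · exfalso
      apply hv1
      have : (v : G) ∈ E := ⟨v.2, by
        rw [← hφ, hk]; rfl⟩
      rw [h, Subgroup.mem_bot] at this
      exact Subtype.ext this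
    · intro n hn
      rw [← h] at hn
      exact hn.2
  obtain ⟨x, hx1⟩ := exists_ne (1 : N)
  refine ⟨x, fun h => hx1 (Subtype.ext h), fun g => ?_⟩
  obtain ⟨k, hk⟩ := hscal g
  rw [hk x x.2]
  exact pow_mem (Subgroup.mem_zpowers _) k

theorem HasCyc.prime [Finite G] (h : HasCyc G) :
    ∃ C : Subgroup G, C.Normal ∧ (Nat.card C).Prime := by
  obtain ⟨x, hx1, hx⟩ := h
  have ho : orderOf x ≠ 1 := fun h => hx1 (orderOf_eq_one_iff.mp h)
  obtain ⟨p, hp, k, hk⟩ := Nat.exists_prime_and_dvd ho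
  have hpos := orderOf_pos x
  have hk0 : k ≠ 0 := by rintro rfl; omega
  refine ⟨Subgroup.zpowers (x ^ k), ⟨?_⟩, ?_⟩
  · rintro _ ⟨j, rfl⟩ g
    obtain ⟨i, hi⟩ := hx g
    refine ⟨i * j, ?_⟩
    simp only at hi ⊢
    rw [← conj_zpow, ← conj_pow, ← hi, zpow_mul, ← zpow_natCast, ← zpow_natCast, ← zpow_mul,
      ← zpow_mul, mul_comm]
    rw [← zpow_mul, ← zpow_mul]
    congr 1
    ring
  · rw [Nat.card_zpowers, orderOf_pow_of_dvd hk0 (hk ▸ Dvd.intro_left _ rfl), hk,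
      Nat.mul_div_cancel _ (Nat.pos_of_ne_zero hk0)]
    exact hp

universe u in
theorem main (n : ℕ) : ∀ (G : Type u) [Group G] [Finite G], Nat.card G = n → Hyp G →
    Red (⊥ : Subgroup G) := by
  induction n using Nat.strong_induction_on with
  | _ n ih =>
  intro G _ _ hn hyp
  by_cases hG : Nat.card G = 1
  · have : (⊥ : Subgroup G) = ⊤ := by
      haveI := (Nat.card_eq_one_iff_unique.mp hG).1
      exact Subsingleton.elim _ _
    rw [this]; exact Red.top
  have hquot : ∀ (r : ℕ) [Fact r.Prime] (N : Subgroup G), N.Normal → N ≠ ⊥ → IsPGroup r N →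
      Red N := by
    intro r _ N hN hne hNr
    apply Red.of_quot
    refine ih (Nat.card (G ⧸ N)) ?_ (G ⧸ N) rfl (hyp.quot N hNr)
    rw [← hn, Subgroup.card_eq_card_quotient_mul_card_subgroup N]
    have h1 : 1 < Nat.card N := by
      rw [Subgroup.one_lt_card_iff_ne_bot]; exact hne
    have h2 : 0 < Nat.card (G ⧸ N) := Nat.card_pos
    nlinarith
  have hcyc : HasCyc G := by
    by_contra hno
    have hstep : ∀ N : Subgroup G, MinNormal N → ∀ p : ℕ, (Nat.card N).minFac = p → p.Prime →
        ∀ P : Sylow p G,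
        (∀ M, IsMaximalSubgroupOf M (P : Subgroup G) → N ≤ M) ∧ N ≤ P ∧ Red N := by
      intro N hN p hpN hp P
      haveI := Fact.mk hp
      have hA := lemA hyp hN hpN P hno
      have hpd : p ∣ Nat.card G := (hpN ▸ Nat.minFac_dvd _ : p ∣ Nat.card N).trans
        (Subgroup.card_subgroup_dvd_card N)
      have hPne : (P : Subgroup G) ≠ ⊥ := P.ne_bot_of_dvd_card hpd
      obtain ⟨M, hM, -⟩ := exists_max (bot_lt_iff_ne_bot.mpr hPne)
      have hNP : N ≤ P := (hA M hM).trans hM.1.le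
      exact ⟨hA, hNP, hquot p N hN.normal hN.ne_bot (P.2.to_le hNP)⟩
    haveI : Nontrivial G := by
      rw [← Finite.one_lt_card_iff_nontrivial]
      have : 0 < Nat.card G := Nat.card_pos
      omega
    obtain ⟨N, hN, -⟩ := exists_minNormal (G := G) (L := ⊤) inferInstance top_ne_bot
    have hp : (Nat.card N).minFac.Prime :=
      Nat.minFac_prime (fun h => hN.ne_bot (Subgroup.card_eq_one.mp h))
    haveI := Fact.mk hp
    obtain ⟨hA, hNP, hred⟩ := hstep N hN _ rfl hp default
    -- the largest prime
    have hne : (Nat.card G).primeFactors.Nonempty := by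
      rw [Nat.nonempty_primeFactors]
      have : 0 < Nat.card G := Nat.card_pos
      omega
    obtain ⟨q, hqm, hqmax⟩ := Finset.exists_max_image _ id hne
    have hq := Nat.prime_of_mem_primeFactors hqm
    haveI := Fact.mk hq
    let Q : Sylow q G := default
    have hQn : (Q : Subgroup G).Normal := sylow_normal (q := q)
      (fun r hr hrd => hqmax r (Nat.mem_primeFactors.mpr ⟨hr, hrd, Nat.card_pos.ne'⟩)) Q _
      hN.normal hNP hA hred
    have hQne : (Q : Subgroup G) ≠ ⊥ := Q.ne_bot_of_dvd_card (Nat.dvd_of_mem_primeFactors hqm)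
    obtain ⟨N₂, hN₂, hNQ⟩ := exists_minNormal hQn hQne
    have hN₂q : IsPGroup q N₂ := Q.2.to_le hNQ
    have hmin : (Nat.card N₂).minFac = q := by
      obtain ⟨m, hm⟩ := IsPGroup.iff_card.mp hN₂q
      rw [hm]
      refine hq.pow_minFac ?_
      rintro rfl
      exact hN₂.ne_bot (Subgroup.card_eq_one.mp (by simpa using hm))
    obtain ⟨hA₂, _, hred₂⟩ := hstep N₂ hN₂ q hmin hq Q
    exact hno (lemB Q hQn hN₂ hNQ hA₂ hred₂)
  obtain ⟨C, hC, hCp⟩ := hcyc.prime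
  haveI := Fact.mk hCp
  refine Red.step ⊥ C inferInstance hC bot_le (by simpa using hCp) (hquot (Nat.card C) C hC ?_ ?_)
  · intro h
    rw [h, Subgroup.card_bot] at hCp
    exact Nat.not_prime_one hCp
  · exact IsPGroup.of_card (n := 1) (by simp)

end CN


theorem stmt4 {G : Type*} [Group G] [Fintype G]
    (h : ∀ p : ℕ, p.Prime → p ∣ Nat.card G → ∀ P : Sylow p G,
      ∀ M : Subgroup G, IsMaximalSubgroupOf M (P : Subgroup G) → M.IsCNormal) :
    IsSupersolvable G := by
  have hyp : CN.Hyp G := by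
    intro p hp P M hM
    haveI := Fact.mk hp
    refine h p hp ?_ P M hM
    rcases P.2.card_eq_or_dvd with h1 | h1
    · exfalso
      have h2 := hM.1
      rw [show (P : Subgroup G) = ⊥ from Subgroup.card_eq_one.mp h1] at h2
      exact not_lt_bot h2
    · exact h1.trans (Subgroup.card_subgroup_dvd_card (P : Subgroup G))
  exact (CN.main _ G rfl hyp).supersolvable
end

section
/- Let G be a finite group, let p be the smallest prime dividing |G|, and let P be a Sylow p-subgroup of G. If every subgroup of P of order p and every subgroup of P of order 4 is c-normal in G, then G is p-nilpotent. -/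
open scoped Pointwise

section helpers

open scoped commutatorElement

def NoPQ (p : ℕ) (G : Type*) [Group G] : Prop :=
  ∀ N : Subgroup G, ∀ _ : N.Normal, IsPGroup p (G ⧸ N) → N = ⊤

/-- Elements of order prime to `p` lie in any normal subgroup with `p`-group quotient. -/
lemma mem_of_pquot {G : Type*} [Group G] [Finite G] {p : ℕ} (hp : p.Prime) (N : Subgroup G)
    [N.Normal] (hq : IsPGroup p (G ⧸ N)) (x : G) (hx : ¬ p ∣ orderOf x) : x ∈ N := by
  have : Fact p.Prime := ⟨hp⟩
  obtain ⟨k, hk⟩ := IsPGroup.iff_orderOf.mp hq (x : G ⧸ N)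
  have h1 : orderOf (x : G ⧸ N) ∣ orderOf x := orderOf_map_dvd (QuotientGroup.mk' N) x
  rw [hk] at h1
  have : k = 0 := by
    by_contra h0
    exact hx ((dvd_pow_self p h0).trans h1)
  subst this
  rw [pow_zero, orderOf_eq_one_iff, QuotientGroup.eq_one_iff] at hk
  exact hk

lemma pquot_of_index {G : Type*} [Group G] {p : ℕ} (N : Subgroup G)
    [N.Normal] {k : ℕ} (hq : N.index = p ^ k) : IsPGroup p (G ⧸ N) :=
  IsPGroup.of_card (n := k) (by rw [← hq]; rfl)

/-- A normal subgroup with `p`-group quotient that is `p`-nilpotent makes `G` `p`-nilpotent. -/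
lemma pnil_of_normal {G : Type*} [Group G] [Finite G] {p : ℕ} (hp : p.Prime) (N : Subgroup G)
    [hN : N.Normal] (hq : IsPGroup p (G ⧸ N)) (h : IsPNilpotent p N) : IsPNilpotent p G := by
  have : Fact p.Prime := ⟨hp⟩
  obtain ⟨K, hK, hKp, k, hk⟩ := h
  have hch : ∀ g : G, g ∈ K.map N.subtype ↔ g ∈ N ∧ ¬ p ∣ orderOf g := by
    intro g
    constructor
    · rintro ⟨y, hy, rfl⟩
      refine ⟨y.2, fun hd => hKp (hd.trans ?_)⟩
      have := Subgroup.orderOf_dvd_natCard K hy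
      simpa using this
    · rintro ⟨hg, hd⟩
      refine ⟨⟨g, hg⟩, ?_, rfl⟩
      exact mem_of_pquot hp K (pquot_of_index K hk) _ (by simpa using hd)
  refine ⟨K.map N.subtype, ⟨?_⟩, ?_, ?_⟩
  · intro n hn g
    rw [hch] at hn ⊢
    refine ⟨hN.conj_mem _ hn.1 g, ?_⟩
    have : orderOf (g * n * g⁻¹) = orderOf n := by
      simpa using orderOf_injective (MulAut.conj g).toMonoidHom (MulAut.conj g).injective n
    rw [this]; exact hn.2
  · rwa [Subgroup.card_map_of_injective N.subtype_injective]
  · obtain ⟨m, hm⟩ := IsPGroup.iff_card.mp hq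
    refine ⟨k + m, ?_⟩
    rw [Subgroup.index_map_subtype, hk, pow_add]
    congr 1

/-- growth of normalizers -/
lemma lt_inf_normalizer {G : Type*} [Group G] [Finite G] {p : ℕ} (hp : p.Prime) (D S : Subgroup G)
    (hS : IsPGroup p S) (h : D < S) : D < S ⊓ Subgroup.normalizer (D : Set G) := by
  have : Fact p.Prime := ⟨hp⟩
  have hnil : Group.IsNilpotent S := hS.isNilpotent
  have hnc : NormalizerCondition S := Group.normalizerCondition_of_isNilpotent
  have hlt : D.subgroupOf S < ⊤ := by
    rw [lt_top_iff_ne_top, Ne, Subgroup.subgroupOf_eq_top]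
    exact not_le_of_gt h
  obtain ⟨y, hy, hy'⟩ := SetLike.exists_of_lt (hnc _ hlt)
  refine lt_of_le_of_ne (le_inf h.le Subgroup.le_normalizer) ?_
  intro he
  apply hy'
  rw [Subgroup.mem_subgroupOf]
  rw [he]
  refine ⟨y.2, ?_⟩
  rw [Subgroup.mem_normalizer_iff] at hy
  refine Subgroup.mem_normalizer_iff.mpr ?_
  intro g
  constructor
  · intro hg
    exact (hy ⟨g, h.le hg⟩).mp hg
  · intro hg
    have hgS : g ∈ S := by
      have := S.mul_mem (S.mul_mem (S.inv_mem y.2) (h.le hg)) y.2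
      simpa [mul_assoc] using this
    exact (hy ⟨g, hgS⟩).mpr hg

/-- Sylow subgroups are conjugate under any normal subgroup with `p`-group quotient. -/
lemma sylow_conj_of_pquot {G : Type*} [Group G] [Finite G] {p : ℕ} (hp : p.Prime) (C : Subgroup G)
    [C.Normal] (hq : IsPGroup p (G ⧸ C)) (M M' : Sylow p G) : ∃ c ∈ C, c • M = M' := by
  have : Fact p.Prime := ⟨hp⟩
  have htop : (M : Subgroup G) ⊔ C = ⊤ := by
    rw [← Subgroup.index_eq_one]
    have h1 : ((M : Subgroup G) ⊔ C).index ∣ (M : Subgroup G).index :=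
      Subgroup.index_dvd_of_le le_sup_left
    have h2 : ((M : Subgroup G) ⊔ C).index ∣ C.index := Subgroup.index_dvd_of_le le_sup_right
    obtain ⟨m, hm⟩ := IsPGroup.iff_card.mp hq
    have hm' : C.index = p ^ m := hm
    rw [hm', Nat.dvd_prime_pow hp] at h2
    obtain ⟨j, -, hj⟩ := h2
    rcases Nat.eq_zero_or_pos j with rfl | h0
    · simpa using hj
    · exact absurd ((dvd_pow_self p h0.ne').trans (hj ▸ h1)) M.not_dvd_index
  obtain ⟨g, hg⟩ := MulAction.exists_smul_eq G M M'
  have hgt : g ∈ C ⊔ (M : Subgroup G) := by rw [sup_comm, htop]; trivial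
  rw [← SetLike.mem_coe, Subgroup.normal_mul] at hgt
  obtain ⟨c, hc, m, hm, rfl⟩ := hgt
  refine ⟨c, hc, ?_⟩
  rw [← hg]
  change c • M = (c * m) • M
  rw [mul_smul]
  congr 1
  symm
  rw [Sylow.smul_eq_iff_mem_normalizer]
  exact Subgroup.le_normalizer hm

/-- The Frobenius condition. -/
def FrobCond (p : ℕ) (G : Type*) [Group G] : Prop :=
  ∀ D : Subgroup G, IsPGroup p D → ∀ x ∈ Subgroup.normalizer (D : Set G), ¬ p ∣ orderOf x →
    x ∈ Subgroup.centralizer (D : Set G)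

lemma FrobCond.pquot {G : Type*} [Group G] [Finite G] {p : ℕ} (hp : p.Prime) (h : FrobCond p G)
    (D : Subgroup G) (hD : IsPGroup p D) :
    ∃ C : Subgroup (Subgroup.normalizer (D : Set G)), ∃ _ : C.Normal,
      (∀ c ∈ C, (c : G) ∈ Subgroup.centralizer (D : Set G)) ∧
      IsPGroup p ((Subgroup.normalizer (D : Set G)) ⧸ C) := by
  refine ⟨(Subgroup.centralizer (D : Set G)).subgroupOf _, ?_, fun c hc => hc, ?_⟩
  · rw [← Subgroup.normalizerMonoidHom_ker]; infer_instance
  · intro n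
    induction n using QuotientGroup.induction_on with
    | H n =>
      obtain ⟨k, m, hm, he⟩ := Nat.exists_eq_pow_mul_and_not_dvd (orderOf_pos n).ne' p hp.ne_one
      refine ⟨k, ?_⟩
      rw [← QuotientGroup.mk_pow, QuotientGroup.eq_one_iff, Subgroup.mem_subgroupOf]
      apply h D hD _ (n ^ p ^ k).2
      have : orderOf (n ^ p ^ k) = m := by
        rw [orderOf_pow_of_dvd (pow_ne_zero _ hp.ne_zero) (he ▸ dvd_mul_right _ _), he,
          Nat.mul_div_cancel_left _ (pow_pos hp.pos k)]
      rwa [Subgroup.orderOf_coe, this]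

lemma FrobCond.conj {G : Type*} [Group G] [Finite G] {p : ℕ} (hp : p.Prime) (h : FrobCond p G)
    (S T : Sylow p G) :
    ∃ c ∈ Subgroup.centralizer (((S : Subgroup G) ⊓ T : Subgroup G) : Set G), c • S = T := by
  have : Fact p.Prime := ⟨hp⟩
  induction hn : Nat.card G - Nat.card ((S : Subgroup G) ⊓ T : Subgroup G) using
    Nat.strong_induction_on generalizing S T with
  | _ n ih =>
  set D := ((S : Subgroup G) ⊓ T : Subgroup G) with hDdef
  by_cases hS : D = S
  · have : S = T := Sylow.ext (S.3 T.2 (inf_eq_left.mp hS)).symm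
    subst this
    exact ⟨1, one_mem _, one_smul _ _⟩
  by_cases hT : D = T
  · have : T = S := Sylow.ext (T.3 S.2 (inf_eq_right.mp hT)).symm
    subst this
    exact ⟨1, one_mem _, one_smul _ _⟩
  have hDS : D < S := lt_of_le_of_ne inf_le_left hS
  have hDT : D < T := lt_of_le_of_ne inf_le_right hT
  have hD : IsPGroup p D := S.2.to_le inf_le_left
  have hSN := lt_inf_normalizer hp D S S.2 hDS
  have hTN := lt_inf_normalizer hp D T T.2 hDT
  set N := Subgroup.normalizer (D : Set G) with hN
  obtain ⟨C, hCn, hC, hCq⟩ := h.pquot hp D hD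
  obtain ⟨M, hM⟩ := (S.2.comap_subtype (K := N)).exists_le_sylow
  obtain ⟨M', hM'⟩ := (T.2.comap_subtype (K := N)).exists_le_sylow
  obtain ⟨c, hc, hcM⟩ := sylow_conj_of_pquot hp C hCq M M'
  obtain ⟨S1, hS1⟩ := (M.2.map N.subtype).exists_le_sylow
  have step : ∀ A B : Sylow p G, D < (A : Subgroup G) ⊓ B →
      ∃ c ∈ Subgroup.centralizer (D : Set G), c • A = B := by
    intro A B hAB
    obtain ⟨c, hc, hc'⟩ := ih (Nat.card G - Nat.card ((A : Subgroup G) ⊓ B : Subgroup G)) (by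
      have h1 : Nat.card D < Nat.card ((A : Subgroup G) ⊓ B : Subgroup G) :=
        Set.ncard_lt_ncard (show (D : Set G) ⊂ _ from hAB) (Set.toFinite _)
      have h2 := Subgroup.card_le_card_group ((A : Subgroup G) ⊓ B : Subgroup G)
      omega) A B rfl
    exact ⟨c, Subgroup.centralizer_le hAB.le hc, hc'⟩
  obtain ⟨a, ha, haS⟩ := step S S1 (lt_of_lt_of_le hSN (by
    rintro s ⟨hs1, hs2⟩
    exact ⟨hs1, hS1 ⟨⟨s, hs2⟩, hM hs1, rfl⟩⟩))
  obtain ⟨b, hb, hbS⟩ := step ((c : G) • S1) T (lt_of_lt_of_le hTN (by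
    rintro s ⟨hs1, hs2⟩
    refine ⟨?_, hs1⟩
    have h1 : (⟨s, hs2⟩ : N) ∈ M' := hM' hs1
    rw [← hcM] at h1
    have h2 : c⁻¹ * (⟨s, hs2⟩ : N) * c ∈ (M : Subgroup N) := by
      have := (Subgroup.mem_pointwise_smul_iff_inv_smul_mem
        (S := (M : Subgroup N)) (a := MulAut.conj c)).mp h1
      simpa [← map_inv] using this
    refine (Subgroup.mem_pointwise_smul_iff_inv_smul_mem
        (S := (S1 : Subgroup G)) (a := MulAut.conj (c : G))).mpr ?_
    have h3 := hS1 ⟨_, h2, rfl⟩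
    simpa [← map_inv] using h3))
  refine ⟨b * c * a, mul_mem (mul_mem hb (hC c hc)) ha, ?_⟩
  rw [mul_smul, mul_smul, haS, hbS]

/-- Frobenius: under the Frobenius condition, without proper `p`-quotients the
Sylow subgroup is trivial. -/
lemma FrobCond.not_dvd {G : Type*} [Group G] [Finite G] {p : ℕ} (hp : p.Prime) (h : FrobCond p G)
    (hno : NoPQ p G) : ¬ p ∣ Nat.card G := by
  have : Fact p.Prime := ⟨hp⟩
  intro hdvd
  obtain ⟨P⟩ : Nonempty (Sylow p G) := inferInstance
  have hker := hno (P : Subgroup G).transferFocal.ker inferInstance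
    ((P.2.to_quotient (P : Subgroup G).focalSubgroupOf).of_equiv
      (Subgroup.transferFocal.quotientKerMulEquivQuotientFocalSubroupOf P).symm)
  have hfoc := Subgroup.ker_transferFocal_inf_eq_focalSubgroup P
  rw [hker, top_inf_eq] at hfoc
  have hle : (P : Subgroup G).focalSubgroup ≤ ⁅(P : Subgroup G), (P : Subgroup G)⁆ := by
    rw [Subgroup.focalSubgroup_def, Subgroup.closure_le]
    rintro g ⟨hg, x, hx, u, rfl⟩
    have hy : u * x * u⁻¹ ∈ (P : Subgroup G) := by
      have := inv_mem (mul_mem (inv_mem hx) hg)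
      simpa [commutatorElement_def, mul_assoc] using this
    obtain ⟨c, hc, hcP⟩ := h.conj hp (u • P) P
    have hyc : c * (u * x * u⁻¹) = (u * x * u⁻¹) * c := by
      refine (Subgroup.mem_centralizer_iff.mp hc _ ⟨?_, hy⟩).symm
      refine (Subgroup.mem_pointwise_smul_iff_inv_smul_mem
        (S := (P : Subgroup G)) (a := MulAut.conj u)).mpr ?_
      simpa [← map_inv, mul_assoc] using hx
    have hn : c * u ∈ Subgroup.normalizer ((P : Subgroup G) : Set G) := by
      rw [← mul_smul] at hcP
      exact Sylow.smul_eq_iff_mem_normalizer.mp hcP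
    set N := Subgroup.normalizer ((P : Subgroup G) : Set G) with hNdef
    obtain ⟨C, hCn, hC, hCq⟩ : ∃ C : Subgroup N, ∃ _ : C.Normal,
      (∀ c ∈ C, (c : G) ∈ Subgroup.centralizer ((P : Subgroup G) : Set G)) ∧
      IsPGroup p (N ⧸ C) := h.pquot hp P P.2
    obtain ⟨d, hd, v, hv, hdv⟩ : ∃ d ∈ Subgroup.centralizer ((P : Subgroup G) : Set G),
        ∃ v ∈ P, c * u = d * v := by
      have hPN : (P : Subgroup G) ≤ N := Subgroup.le_normalizer
      have htop : C ⊔ ((P.subtype hPN : Sylow p N) : Subgroup N) = ⊤ := by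
        rw [← Subgroup.index_eq_one]
        have h1 := Subgroup.index_dvd_of_le
          (le_sup_right : _ ≤ C ⊔ ((P.subtype hPN : Sylow p N) : Subgroup N))
        have h2 := Subgroup.index_dvd_of_le
          (le_sup_left : _ ≤ C ⊔ ((P.subtype hPN : Sylow p N) : Subgroup N))
        obtain ⟨m, hm⟩ := IsPGroup.iff_card.mp hCq
        have hm' : C.index = p ^ m := hm
        rw [hm', Nat.dvd_prime_pow hp] at h2
        obtain ⟨j, -, hj⟩ := h2
        rcases Nat.eq_zero_or_pos j with rfl | h0
        · simpa using hj
        · exact absurd ((dvd_pow_self p h0.ne').trans (hj ▸ h1)) (Sylow.not_dvd_index _)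
      have hmem : (⟨c * u, hn⟩ : N) ∈ C ⊔ ((P.subtype hPN : Sylow p N) : Subgroup N) := by
        rw [htop]; trivial
      rw [← SetLike.mem_coe, Subgroup.normal_mul] at hmem
      obtain ⟨d, hd, v, hv, he⟩ := hmem
      exact ⟨d, hC d hd, v, hv, (congrArg Subtype.val he).symm⟩
    have hvP : v * x * v⁻¹ ∈ (P : Subgroup G) := mul_mem (mul_mem hv hx) (inv_mem hv)
    have e1 : u * x * u⁻¹ = v * x * v⁻¹ := by
      have hdc := Subgroup.mem_centralizer_iff.mp hd _ hvP
      calc u * x * u⁻¹ = (u * x * u⁻¹) * c * c⁻¹ := by group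
        _ = c * (u * x * u⁻¹) * c⁻¹ := by rw [hyc]
        _ = (c * u) * x * (c * u)⁻¹ := by group
        _ = (d * v) * x * (d * v)⁻¹ := by rw [hdv]
        _ = (d * (v * x * v⁻¹)) * d⁻¹ := by group
        _ = ((v * x * v⁻¹) * d) * d⁻¹ := by rw [hdc]
        _ = _ := by group
    have e2 : ⁅x, u⁆ = ⁅x, v⁆ := by
      calc ⁅x, u⁆ = x * (u * x * u⁻¹)⁻¹ := by rw [commutatorElement_def]; group
        _ = x * (v * x * v⁻¹)⁻¹ := by rw [e1]
        _ = _ := by rw [commutatorElement_def]; group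
    rw [e2]
    exact Subgroup.commutator_mem_commutator hx hv
  have hbot : Nontrivial P := by
    refine (Subgroup.nontrivial_iff_ne_bot _).mpr ?_
    exact P.ne_bot_of_dvd_card hdvd
  have hnil : Group.IsNilpotent P := P.2.isNilpotent
  have hlt := Group.IsSolvable.commutator_lt_top_of_nontrivial P
  apply hlt.ne
  rw [← hfoc] at hle
  rw [eq_top_iff, ← (Subgroup.map_le_map_iff_of_injective (Subgroup.subtype_injective (P : Subgroup G)))]
  have := Subgroup.map_subtype_commutator (P : Subgroup G)
  rw [this]
  intro y hy
  obtain ⟨z, -, rfl⟩ := hy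
  exact hle z.2

/-- In a `p`-nilpotent group, an element of order prime to `p` normalizing a `p`-subgroup centralizes it. -/
lemma comm_of_pnil {G : Type*} [Group G] [Finite G] {p : ℕ} (hp : p.Prime)
    (h : IsPNilpotent p G) (R : Subgroup G) (hR : IsPGroup p R) (x : G)
    (hxR : x ∈ Subgroup.normalizer (R : Set G)) (hx : ¬ p ∣ orderOf x) (r : G) (hr : r ∈ R) :
    x * r = r * x := by
  have : Fact p.Prime := ⟨hp⟩
  obtain ⟨K, hK, hKp, k, hk⟩ := h
  have hxK : x ∈ K := mem_of_pquot hp K (pquot_of_index K hk) x hx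
  have h1 : ⁅x, r⁆ ∈ K := by
    have := mul_mem hxK (hK.conj_mem _ (inv_mem hxK) r)
    simpa [commutatorElement_def, mul_assoc] using this
  have h2 : ⁅x, r⁆ ∈ R := mul_mem ((Subgroup.mem_normalizer_iff.mp hxR r).mp hr) (inv_mem hr)
  have h3 : ⁅x, r⁆ = 1 := by
    by_contra hne
    have hd := hR.dvd_orderOf (g := ⟨_, h2⟩) (by simpa [Subtype.ext_iff] using hne)
    rw [Subgroup.orderOf_mk] at hd
    exact hKp (hd.trans (Subgroup.orderOf_dvd_natCard K h1))
  exact commutatorElement_eq_one_iff_mul_comm.mp h3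

lemma pow_mul_comm_class2 {G : Type*} [Group G] (u c : G) (hz : ⁅u, c⁆ ∈ Subgroup.center G)
    (n : ℕ) : u ^ n * c = ⁅u, c⁆ ^ n * (c * u ^ n) := by
  set z := ⁅u, c⁆ with hzdef
  have huc : u * c = z * (c * u) := by rw [hzdef, commutatorElement_def]; group
  have hzc : ∀ g, Commute g z := fun g => (Subgroup.mem_center_iff.mp hz g)
  induction n with
  | zero => simp
  | succ n ih =>
    calc u ^ (n + 1) * c = u * (u ^ n * c) := by rw [pow_succ']; group
      _ = u * z ^ n * (c * u ^ n) := by rw [ih]; group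
      _ = z ^ n * u * (c * u ^ n) := by rw [((hzc u).pow_right n).eq]
      _ = z ^ n * (u * c) * u ^ n := by group
      _ = z ^ n * (z * (c * u)) * u ^ n := by rw [huc]
      _ = (z ^ n * z) * (c * (u * u ^ n)) := by group
      _ = _ := by rw [← pow_succ, ← pow_succ']

lemma mul_pow_class2 {G : Type*} [Group G] (u c : G) (hz : ⁅u, c⁆ ∈ Subgroup.center G)
    (n : ℕ) : (c * u) ^ n = c ^ n * u ^ n * ⁅u, c⁆ ^ (n.choose 2) := by
  have hzc : ∀ g, Commute g ⁅u, c⁆ := fun g => (Subgroup.mem_center_iff.mp hz g)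
  have hu := pow_mul_comm_class2 u c hz
  set z := ⁅u, c⁆ with hzdef
  induction n with
  | zero => simp
  | succ n ih =>
    have hch : (n + 1).choose 2 = n + n.choose 2 := by
      rw [Nat.choose_succ_succ' n 1, Nat.choose_one_right]
    calc (c * u) ^ (n + 1) = c ^ n * u ^ n * z ^ (n.choose 2) * (c * u) := by rw [pow_succ, ih]
      _ = c ^ n * u ^ n * (z ^ (n.choose 2) * (c * u)) := by group
      _ = c ^ n * u ^ n * ((c * u) * z ^ (n.choose 2)) := by
        rw [((hzc (c * u)).pow_right _).eq]
      _ = c ^ n * (u ^ n * c) * u * z ^ (n.choose 2) := by group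
      _ = c ^ n * (z ^ n * (c * u ^ n)) * u * z ^ (n.choose 2) := by rw [hu]
      _ = c ^ n * (z ^ n * (c * u ^ n * u)) * z ^ (n.choose 2) := by group
      _ = c ^ n * ((c * u ^ n * u) * z ^ n) * z ^ (n.choose 2) := by
        rw [((hzc (c * u ^ n * u)).pow_right _).eq]
      _ = (c ^ n * c) * (u ^ n * u) * (z ^ n * z ^ (n.choose 2)) := by group
      _ = _ := by rw [← pow_succ, ← pow_succ, ← pow_add, hch]

/-- The subgroup generated by commutators and `p`-th powers. -/
def phiSub {G : Type*} [Group G] (p : ℕ) (D : Subgroup G) : Subgroup G :=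
  Subgroup.closure {g | (∃ u ∈ D, g = u ^ p) ∨ ∃ u ∈ D, ∃ v ∈ D, g = ⁅u, v⁆}

lemma phiSub_le {G : Type*} [Group G] (p : ℕ) (D : Subgroup G) : phiSub p D ≤ D := by
  rw [phiSub, Subgroup.closure_le]
  rintro g (⟨u, hu, rfl⟩ | ⟨u, hu, v, hv, rfl⟩)
  · exact pow_mem hu p
  · exact mul_mem (mul_mem (mul_mem hu hv) (inv_mem hu)) (inv_mem hv)

lemma phiSub_normal {G : Type*} [Group G] (p : ℕ) (D : Subgroup G) (hD : D.Normal) :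
    (phiSub p D).Normal := by
  refine ⟨fun n hn g => ?_⟩
  have : (phiSub p D).map (MulAut.conj g).toMonoidHom ≤ phiSub p D := by
    rw [phiSub, MonoidHom.map_closure, Subgroup.closure_le]
    rintro _ ⟨y, (⟨u, hu, rfl⟩ | ⟨u, hu, v, hv, rfl⟩), rfl⟩
    · refine Subgroup.subset_closure (Or.inl ⟨g * u * g⁻¹, hD.conj_mem u hu g, ?_⟩)
      simp
    · refine Subgroup.subset_closure (Or.inr ⟨g * u * g⁻¹, hD.conj_mem u hu g,
        g * v * g⁻¹, hD.conj_mem v hv g, ?_⟩)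
      simp [commutatorElement_def, mul_assoc]
  simpa using this ⟨n, hn, rfl⟩

lemma phiSub_ne {G : Type*} [Group G] [Finite G] {p : ℕ} (hp : p.Prime) (D : Subgroup G)
    (hD : IsPGroup p D) (hne : Nontrivial D) : phiSub p D ≠ D := by
  have : Fact p.Prime := ⟨hp⟩
  have hnil : Group.IsNilpotent D := hD.isNilpotent
  have hlt := Group.IsSolvable.commutator_lt_top_of_nontrivial D
  have hAn : Nontrivial (Abelianization D) :=
    (QuotientGroup.nontrivial_iff).mpr hlt.ne
  have hA : IsPGroup p (Abelianization D) := hD.to_quotient _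
  have hfin : Finite (Abelianization D) := Quotient.finite _
  have hns : ¬ Function.Surjective (powMonoidHom p : Abelianization D →* Abelianization D) := by
    intro hs
    have hinj := Finite.injective_iff_surjective.mpr hs
    have hd : p ∣ Nat.card (Abelianization D) := by
      rcases hA.card_eq_or_dvd with h | h
      · exact absurd h (Finite.one_lt_card).ne'
      · exact h
    obtain ⟨a, ha⟩ := exists_prime_orderOf_dvd_card' p hd
    have h1 : a = 1 := hinj (by simp [powMonoidHom_apply, ← ha, pow_orderOf_eq_one])
    rw [h1, orderOf_one] at ha
    exact hp.ne_one ha.symm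
  intro he
  set K : Subgroup D := (powMonoidHom p : Abelianization D →* Abelianization D).range.comap
    Abelianization.of with hK
  have hle : phiSub p D ≤ K.map D.subtype := by
    rw [phiSub, Subgroup.closure_le]
    rintro g (⟨u, hu, rfl⟩ | ⟨u, hu, v, hv, rfl⟩)
    · exact ⟨⟨u, hu⟩ ^ p, ⟨Abelianization.of ⟨u, hu⟩, (map_pow _ _ _).symm⟩, by simp⟩
    · refine ⟨⁅(⟨u, hu⟩ : D), (⟨v, hv⟩ : D)⁆, ⟨1, ?_⟩, rfl⟩
      rw [map_one, map_commutatorElement, commutatorElement_eq_one_iff_mul_comm.mpr (mul_comm _ _)]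
  apply hns
  intro a
  obtain ⟨d, rfl⟩ := QuotientGroup.mk_surjective a
  obtain ⟨d', hd', hdd⟩ := hle (he.symm ▸ d.2 : (d : G) ∈ phiSub p D)
  have : d' = d := Subtype.ext hdd
  subst this
  exact hd'

lemma frob_of_min {G : Type*} [Group G] [Finite G] {p : ℕ} (hp : p.Prime) (hno : NoPQ p G)
    (hsub : ∀ L : Subgroup G, L ≠ ⊤ → IsPNilpotent p L)
    (hcent : ∀ g : G, (orderOf g = p ∨ (p = 2 ∧ orderOf g = 4)) → g ∈ Subgroup.center G) :
    FrobCond p G := by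
  have : Fact p.Prime := ⟨hp⟩
  intro D hD x hxD hx
  have claim0 : ∀ R : Subgroup G, IsPGroup p R → x ∈ Subgroup.normalizer (R : Set G) →
      R ⊔ Subgroup.zpowers x ≠ ⊤ → ∀ r ∈ R, x * r = r * x := by
    intro R hR hxR hne r hr
    set L := R ⊔ Subgroup.zpowers x with hL
    have hRL : R ≤ L := le_sup_left
    have hxL : x ∈ L := (le_sup_right : _ ≤ L) (Subgroup.mem_zpowers x)
    have := comm_of_pnil hp (hsub L hne) (R.subgroupOf L) hR.comap_subtype ⟨x, hxL⟩
      (Subgroup.mem_normalizer_iff.mpr fun y => Subgroup.mem_normalizer_iff.mp hxR y)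
      (by rwa [Subgroup.orderOf_mk]) ⟨r, hRL hr⟩ hr
    exact congrArg Subtype.val this
  by_contra hcon
  have htop : D ⊔ Subgroup.zpowers x = ⊤ := by
    by_contra hne
    exact hcon (Subgroup.mem_centralizer_iff.mpr fun r hr => (claim0 D hD hxD hne r hr).symm)
  have hDn : D.Normal := by
    rw [← Subgroup.normalizer_eq_top_iff, eq_top_iff, ← htop]
    exact sup_le Subgroup.le_normalizer ((Subgroup.zpowers_le).mpr hxD)
  have hpow : ∀ g ∈ D, g ∈ Subgroup.zpowers x → g = 1 := by
    intro g hg hgx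
    by_contra hne
    have hd := hD.dvd_orderOf (g := ⟨g, hg⟩) (by simpa [Subtype.ext_iff] using hne)
    rw [Subgroup.orderOf_mk] at hd
    exact hx (hd.trans (orderOf_dvd_of_mem_zpowers hgx))
  have claim1 : ∀ R : Subgroup G, R.Normal → R ≤ D → R ≠ D → R ≤ Subgroup.center G := by
    intro R hRn hRD hne
    have hRt : R ⊔ Subgroup.zpowers x ≠ ⊤ := by
      intro ht
      apply hne
      refine le_antisymm hRD fun d hd => ?_
      have hd' : d ∈ R ⊔ Subgroup.zpowers x := by rw [ht]; trivial
      rw [← SetLike.mem_coe, Subgroup.normal_mul] at hd'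
      obtain ⟨r, hr, y, hy, rfl⟩ := hd'
      have hyD : y ∈ D := (Subgroup.mul_mem_cancel_left D (hRD hr)).mp hd
      have : y = 1 := hpow y hyD hy
      subst this
      simpa using hr
    have hcom := claim0 R (hD.to_le hRD) (by rw [Subgroup.normalizer_eq_top]; trivial) hRt
    have hxC : x ∈ Subgroup.centralizer (R : Set G) :=
      Subgroup.mem_centralizer_iff.mpr fun r hr => (hcom r hr).symm
    have hC := hno (Subgroup.centralizer (R : Set G)) inferInstance (by
      intro g
      induction g using QuotientGroup.induction_on with
      | H g =>
        have hg : g ∈ D ⊔ Subgroup.zpowers x := by rw [htop]; trivial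
        rw [← SetLike.mem_coe, Subgroup.normal_mul] at hg
        obtain ⟨d, hd, y, hy, rfl⟩ := hg
        obtain ⟨k, hk⟩ := hD ⟨d, hd⟩
        refine ⟨k, ?_⟩
        have hyC : (y : G ⧸ Subgroup.centralizer (R : Set G)) = 1 :=
          (QuotientGroup.eq_one_iff y).mpr ((Subgroup.zpowers_le.mpr hxC) hy)
        have hk' : d ^ p ^ k = 1 := by simpa using congrArg Subtype.val hk
        change ((d * y : G) : G ⧸ Subgroup.centralizer (R : Set G)) ^ p ^ k = 1
        rw [QuotientGroup.mk_mul, hyC, mul_one, ← QuotientGroup.mk_pow, hk', QuotientGroup.mk_one])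
    intro r hr
    rw [Subgroup.mem_center_iff]
    intro g
    have hg : g ∈ Subgroup.centralizer (R : Set G) := by rw [hC]; trivial
    exact (Subgroup.mem_centralizer_iff.mp hg r hr).symm
  have hnt : Nontrivial D := by
    rw [Subgroup.nontrivial_iff_ne_bot]
    rintro rfl
    apply hcon
    rw [Subgroup.mem_centralizer_iff]
    intro r hr
    rw [Subgroup.mem_bot.mp hr]; simp
  have hphi := claim1 _ (phiSub_normal p D hDn) (phiSub_le p D) (phiSub_ne hp D hD hnt)
  apply hcon
  rw [Subgroup.mem_centralizer_iff]
  intro u hu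
  set c := x * u * x⁻¹ * u⁻¹ with hcdef
  have hcD : c ∈ D := mul_mem (hDn.conj_mem u hu x) (inv_mem hu)
  have hcu : c * u = x * u * x⁻¹ := by rw [hcdef]; group
  have hup : u ^ p ∈ Subgroup.center G :=
    hphi (Subgroup.subset_closure (Or.inl ⟨u, hu, rfl⟩))
  have hz : ⁅u, c⁆ ∈ Subgroup.center G :=
    hphi (Subgroup.subset_closure (Or.inr ⟨u, hu, c, hcD, rfl⟩))
  have hzp : ⁅u, c⁆ ^ p = 1 := by
    have h1 := pow_mul_comm_class2 u c hz p
    rw [← Subgroup.mem_center_iff.mp hup c] at h1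
    exact (right_eq_mul.mp h1)
  have hcp : c ^ p * ⁅u, c⁆ ^ (p.choose 2) = 1 := by
    have h1 := mul_pow_class2 u c hz p
    rw [hcu, conj_pow, Subgroup.mem_center_iff.mp hup x, mul_assoc, mul_inv_cancel, mul_one,
      Subgroup.mem_center_iff.mp hup (c ^ p), mul_assoc] at h1
    exact (left_eq_mul.mp h1)
  have hcc : c ∈ Subgroup.center G := by
    by_cases hc1 : c = 1
    · rw [hc1]; exact one_mem _
    apply hcent
    rcases hp.eq_two_or_odd' with h2 | hodd
    · subst h2
      have h4 : c ^ 2 ^ 2 = 1 := by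
        have hz2 : c ^ 2 = ⁅u, c⁆⁻¹ := by
          rw [Nat.choose_self, pow_one] at hcp
          exact eq_inv_of_mul_eq_one_left hcp
        calc c ^ 2 ^ 2 = (c ^ 2) ^ 2 := by rw [← pow_mul]; norm_num
          _ = 1 := by rw [hz2, inv_pow, hzp, inv_one]
      obtain ⟨j, hj, hje⟩ := (Nat.dvd_prime_pow Nat.prime_two).mp (orderOf_dvd_of_pow_eq_one h4)
      interval_cases j
      · exact absurd (orderOf_eq_one_iff.mp (by simpa using hje)) hc1
      · left; simpa using hje
      · right; exact ⟨rfl, by simpa using hje⟩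
    · left
      have hd : p ∣ p.choose 2 := by
        apply hp.dvd_choose_self (by norm_num)
        rcases hp.two_le.lt_or_eq with h | h
        · exact h
        · subst h; exact absurd hodd (by decide)
      obtain ⟨m, hm⟩ := hd
      rw [hm, pow_mul, hzp, one_pow, mul_one] at hcp
      exact orderOf_eq_prime hcp hc1
  have hxn : ∀ n : ℕ, x ^ n * u = c ^ n * (u * x ^ n) := by
    have hcx : ∀ g, Commute g c := fun g => Subgroup.mem_center_iff.mp hcc g
    have hxu : x * u = c * (u * x) := by rw [hcdef]; group
    intro n
    induction n with
    | zero => simp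
    | succ n ih =>
      calc x ^ (n + 1) * u = x * (x ^ n * u) := by rw [pow_succ']; group
        _ = x * c ^ n * (u * x ^ n) := by rw [ih]; group
        _ = c ^ n * x * (u * x ^ n) := by rw [((hcx x).pow_right n).eq]
        _ = c ^ n * (x * u) * x ^ n := by group
        _ = c ^ n * (c * (u * x)) * x ^ n := by rw [hxu]
        _ = (c ^ n * c) * (u * (x * x ^ n)) := by group
        _ = _ := by rw [← pow_succ, ← pow_succ']
  have hc1 : c = 1 := by
    have h1 := hxn (orderOf x)
    rw [pow_orderOf_eq_one, one_mul, mul_one] at h1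
    have h2 : c ^ orderOf x = 1 := right_eq_mul.mp h1
    by_contra hne
    have hd := hD.dvd_orderOf (g := ⟨c, hcD⟩) (by simpa [Subtype.ext_iff] using hne)
    rw [Subgroup.orderOf_mk] at hd
    exact hx (hd.trans (orderOf_dvd_of_pow_eq_one h2))
  have h1 := hxn 1
  rw [hc1] at h1
  simpa using h1.symm

lemma pnil_of_not_dvd {G : Type*} [Group G] {p : ℕ} (h : ¬ p ∣ Nat.card G) :
    IsPNilpotent p G :=
  ⟨⊤, inferInstance, by simpa using h, 0, by simp⟩

/-- The theorem of Ito. -/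
lemma ito (n : ℕ) : ∀ {G : Type*} [Group G] [Finite G] {p : ℕ}, Nat.card G = n → p.Prime →
    (∀ g : G, (orderOf g = p ∨ (p = 2 ∧ orderOf g = 4)) → g ∈ Subgroup.center G) →
    IsPNilpotent p G := by
  induction n using Nat.strong_induction_on with
  | _ n ih =>
  intro G _ _ p hn hp hcent
  have hsub : ∀ L : Subgroup G, L ≠ ⊤ → IsPNilpotent p L := by
    intro L hL
    refine ih (Nat.card L) ?_ rfl hp ?_
    · rw [← hn]
      refine lt_of_le_of_ne (Subgroup.card_le_card_group L) fun h => hL (Subgroup.eq_top_of_card_eq L h)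
    · intro g hg
      rw [← Subgroup.orderOf_coe] at hg
      have := Subgroup.mem_center_iff.mp (hcent g hg)
      exact Subgroup.mem_center_iff.mpr fun y => Subtype.ext (this y)
  by_cases hno : NoPQ p G
  · exact pnil_of_not_dvd ((frob_of_min hp hno hsub hcent).not_dvd hp hno)
  · unfold NoPQ at hno
    push Not at hno
    obtain ⟨N, hN, hq, hne⟩ := hno
    exact pnil_of_normal hp N hq (hsub N hne)

lemma central_of_normal {G : Type*} [Group G] [Finite G] {p : ℕ} (hp : p.Prime)
    (hmin : ∀ q : ℕ, q.Prime → q ∣ Nat.card G → p ≤ q) (hno : NoPQ p G) (g : G)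
    (hg : orderOf g = p ∨ (p = 2 ∧ orderOf g = 4)) (hN : (Subgroup.zpowers g).Normal) :
    g ∈ Subgroup.center G := by
  have : Fact p.Prime := ⟨hp⟩
  set f : G →* MulAut (Subgroup.zpowers g) := MulAut.conjNormal with hf
  have hker : f.ker = ⊤ := by
    have h1 : f.ker.index ∣ Nat.totient (orderOf g) := by
      have := Subgroup.card_subgroup_dvd_card f.range
      rw [IsCyclic.card_mulAut, Nat.card_zpowers] at this
      rwa [Subgroup.index_ker]
    rcases hg with hg | ⟨rfl, hg⟩
    · rw [← Subgroup.index_eq_one]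
      by_contra hne
      obtain ⟨q, hq, hqd⟩ := Nat.exists_prime_and_dvd hne
      have h2 := hmin q hq (hqd.trans (Subgroup.index_dvd_card _))
      rw [hg, Nat.totient_prime hp] at h1
      have h3 := Nat.le_of_dvd (by have := hp.two_le; omega) (hqd.trans h1)
      have := hp.two_le
      omega
    · have ht : Nat.totient 4 = 2 ^ 1 := by decide
      rw [hg, ht, Nat.dvd_prime_pow Nat.prime_two] at h1
      obtain ⟨j, -, hj⟩ := h1
      exact hno _ inferInstance (pquot_of_index _ hj)
  rw [Subgroup.mem_center_iff]
  intro y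
  have hy : y ∈ f.ker := by rw [hker]; trivial
  have h1 := congrArg (fun e : MulAut (Subgroup.zpowers g) =>
    ((e ⟨g, Subgroup.mem_zpowers g⟩ : Subgroup.zpowers g) : G)) (MonoidHom.mem_ker.mp hy)
  simp only [hf, MulAut.conjNormal_apply, MulAut.one_apply] at h1
  exact mul_inv_eq_iff_eq_mul.mp h1

lemma pnil_of_cnormal (n : ℕ) : ∀ {G : Type*} [Group G] [Finite G] {p : ℕ}, Nat.card G = n →
    p.Prime → (∀ q : ℕ, q.Prime → q ∣ Nat.card G → p ≤ q) →
    (∀ g : G, (orderOf g = p ∨ (p = 2 ∧ orderOf g = 4)) → (Subgroup.zpowers g).IsCNormal) →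
    IsPNilpotent p G := by
  induction n using Nat.strong_induction_on with
  | _ n ih =>
  intro G _ _ p hn hp hmin hc
  by_cases hno : NoPQ p G
  · refine ito (Nat.card G) rfl hp fun g hg => central_of_normal hp hmin hno g hg ?_
    obtain ⟨T, hT, hHT, hcore⟩ := hc g hg
    have hTt : T = ⊤ := by
      apply hno T hT
      intro y
      induction y using QuotientGroup.induction_on with
      | H y =>
        have hy : y ∈ ((Subgroup.zpowers g : Subgroup G) : Set G) * (T : Set G) := by
          rw [hHT]; trivial
        obtain ⟨a, ha, t, ht, rfl⟩ := hy
        obtain ⟨k, hk⟩ : ∃ k, orderOf g = p ^ k := by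
          rcases hg with hg | ⟨rfl, hg⟩
          · exact ⟨1, by simpa using hg⟩
          · exact ⟨2, by simpa using hg⟩
        refine ⟨k, ?_⟩
        have hak : a ^ p ^ k = 1 := by
          rw [← hk]; exact orderOf_dvd_iff_pow_eq_one.mp (orderOf_dvd_of_mem_zpowers ha)
        have ht' : (t : G ⧸ T) = 1 := (QuotientGroup.eq_one_iff t).mpr ht
        change ((a * t : G) : G ⧸ T) ^ p ^ k = 1
        rw [QuotientGroup.mk_mul, ht', mul_one, ← QuotientGroup.mk_pow, hak, QuotientGroup.mk_one]
    rw [hTt, inf_top_eq] at hcore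
    have := le_antisymm hcore (Subgroup.normalCore_le _)
    rw [this]
    infer_instance
  · unfold NoPQ at hno
    push Not at hno
    obtain ⟨N, hN, hq, hne⟩ := hno
    refine pnil_of_normal hp N hq (ih (Nat.card N) ?_ rfl hp ?_ ?_)
    · rw [← hn]
      exact lt_of_le_of_ne (Subgroup.card_le_card_group N)
        fun h => hne (Subgroup.eq_top_of_card_eq N h)
    · exact fun q hq hd => hmin q hq (hd.trans (Subgroup.card_subgroup_dvd_card N))
    · intro g hg
      rw [← Subgroup.orderOf_coe] at hg
      obtain ⟨T, hT, hHT, hcore⟩ := hc g hg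
      refine ⟨T.subgroupOf N, inferInstance, ?_, ?_⟩
      · rw [Set.eq_univ_iff_forall]
        intro y
        have hy : (y : G) ∈ ((Subgroup.zpowers (g : G) : Subgroup G) : Set G) * (T : Set G) := by
          rw [hHT]; trivial
        obtain ⟨a, ⟨k, rfl⟩, t, ht, he⟩ := hy
        have he' : (g : G) ^ k * t = y := he
        have htN : t ∈ N := by
          have h1 : (g : G) ^ k ∈ N := zpow_mem g.2 k
          exact (Subgroup.mul_mem_cancel_left N h1).mp (he' ▸ y.2)
        exact ⟨g ^ k, ⟨k, rfl⟩, ⟨t, htN⟩, ht, Subtype.ext (by simpa using he')⟩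
      · rintro a ⟨⟨k, rfl⟩, haT⟩
        have h1 := hcore (⟨⟨k, rfl⟩, by simpa using Subgroup.mem_subgroupOf.mp haT⟩ :
          (g : G) ^ k ∈ Subgroup.zpowers (g : G) ⊓ T)
        intro b
        obtain ⟨j, hj⟩ := h1 (b : G)
        exact ⟨j, Subtype.ext (by simpa using hj)⟩

/-- c-normality is invariant under conjugation. -/
lemma cnormal_conj {G : Type*} [Group G] (H : Subgroup G) (a : G)
    (h : (H.map (MulAut.conj a).toMonoidHom).IsCNormal) : H.IsCNormal := by
  obtain ⟨T, hT, hHT, hcore⟩ := h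
  refine ⟨T, hT, ?_, ?_⟩
  · rw [Set.eq_univ_iff_forall]
    intro y
    have hy : a * y * a⁻¹ ∈ ((H.map (MulAut.conj a).toMonoidHom : Subgroup G) : Set G) * (T : Set G) := by
      rw [hHT]; trivial
    obtain ⟨_, ⟨k, hk, rfl⟩, t, ht, he⟩ := hy
    refine ⟨k, hk, a⁻¹ * t * a, ?_, ?_⟩
    · simpa using hT.conj_mem t ht a⁻¹
    · have he' : (a * k * a⁻¹) * t = a * y * a⁻¹ := he
      change k * (a⁻¹ * t * a) = y
      calc k * (a⁻¹ * t * a) = a⁻¹ * ((a * k * a⁻¹) * t) * a := by group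
        _ = y := by rw [he']; group
  · rintro k ⟨hk, hkT⟩
    have h1 := hcore (⟨⟨k, hk, rfl⟩, hT.conj_mem k hkT a⟩ :
      a * k * a⁻¹ ∈ H.map (MulAut.conj a).toMonoidHom ⊓ T)
    intro b
    obtain ⟨m, hm, he⟩ := h1 (a * b * a⁻¹)
    have he' : a * m * a⁻¹ = a * b * a⁻¹ * (a * k * a⁻¹) * (a * b * a⁻¹)⁻¹ := he
    have : b * k * b⁻¹ = m := by
      calc b * k * b⁻¹ = a⁻¹ * (a * b * a⁻¹ * (a * k * a⁻¹) * (a * b * a⁻¹)⁻¹) * a := by group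
        _ = m := by rw [← he']; group
    rw [this]; exact hm

end helpers

theorem stmt5 {G : Type*} [Group G] [Fintype G] {p : ℕ}
    (hp : p.Prime) (hdvd : p ∣ Nat.card G)
    (hmin : ∀ q : ℕ, q.Prime → q ∣ Nat.card G → p ≤ q)
    (P : Sylow p G)
    (h : ∀ H : Subgroup G, H ≤ (P : Subgroup G) →
      (Nat.card H = p ∨ Nat.card H = 4) → H.IsCNormal) :
    IsPNilpotent p G := by
  have : Fact p.Prime := ⟨hp⟩
  refine pnil_of_cnormal (Nat.card G) rfl hp hmin fun g hg => ?_
  have hpg : IsPGroup p (Subgroup.zpowers g) := by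
    rcases hg with hg | ⟨rfl, hg⟩
    · exact IsPGroup.of_card (n := 1) (by rw [Nat.card_zpowers, hg, pow_one])
    · exact IsPGroup.of_card (n := 2) (by rw [Nat.card_zpowers, hg]; rfl)
  obtain ⟨Q, hQ⟩ := hpg.exists_le_sylow
  obtain ⟨a, ha⟩ := MulAction.exists_smul_eq G Q P
  apply cnormal_conj _ a
  apply h
  · rw [← ha]
    rintro _ ⟨y, hy, rfl⟩
    exact ⟨y, hQ hy, rfl⟩
  · rw [Subgroup.card_map_of_injective (MulAut.conj a).injective, Nat.card_zpowers]
    rcases hg with hg | ⟨-, hg⟩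
    · exact Or.inl hg
    · exact Or.inr hg
end
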